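/- arXiv:1704.04252 — 2 statements merged into one kernel-verified Lean document; each statement's English description precedes it below -/
import Mathlib

section
/- Let p̄ = (p_n)_{n≥0} be a sequence with p_n ∈ (0,1), let G = G_{p̄} be the associated inhomogeneous random walk operator on ℤ_+, and let X be c_0 or l^q for some q ≥ 1. Suppose there exist n_0 ∈ ℕ and α > 0 such that p_n ≥ 1/2 + α for all n ≥ n_0. Then there exists δ > 1 such that for every λ ∈ ℂ with |λ| > δ, the operator λG is frequently hypercyclic and Devaney chaotic on X. -/
open Filter

/-- The transition operator of the spatially inhomogeneous simple random walk on `ℤ₊`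
with jump probabilities `p̄ = (pₙ)`: `(G x)_0 = (1-p₀) x_0 + p₀ x_1` and
`(G x)_i = (1-pᵢ) x_{i-1} + pᵢ x_{i+1}` for `i ≥ 1`. -/
noncomputable def Gop (p : ℕ → ℝ) (x : ℕ → ℂ) : ℕ → ℂ := fun i =>
  if i = 0 then ((1 - p 0 : ℝ) : ℂ) * x 0 + ((p 0 : ℝ) : ℂ) * x 1
  else ((1 - p i : ℝ) : ℂ) * x (i - 1) + ((p i : ℝ) : ℂ) * x (i + 1)

/-- The weights associated to `p̄`: for `n` even, `wₙ = ∏_{k odd, 1 ≤ k ≤ n-1} (1-pₖ)/pₖ`;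
for `n` odd, `wₙ = ∏_{k even, 0 ≤ k ≤ n-1} (1-pₖ)/pₖ`. -/
noncomputable def wseq (p : ℕ → ℝ) (n : ℕ) : ℝ :=
  if n % 2 = 0 then ∏ k ∈ (Finset.range n).filter (fun k => k % 2 = 1), (1 - p k) / p k
  else ∏ k ∈ (Finset.range n).filter (fun k => k % 2 = 0), (1 - p k) / p k

/-- Membership in `c₀`: sequences tending to `0`. -/
def memc0 (x : ℕ → ℂ) : Prop := Filter.Tendsto x Filter.atTop (nhds 0)

/-- Membership in `ℓ^q`: `∑ ‖x n‖^q < ∞`. -/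
def memlq (q : ℝ) (x : ℕ → ℂ) : Prop := Summable (fun n => ‖x n‖ ^ q)

/-- Sup-norm distance between `x` and `z` is (at most) `ε`, coordinatewise strict form. -/
def distC0lt (x z : ℕ → ℂ) (ε : ℝ) : Prop := ∀ i, ‖x i - z i‖ < ε

/-- The `q`-th power of the `ℓ^q` distance between `x` and `z` is `< ε`. -/
def distLqlt (q : ℝ) (x z : ℕ → ℂ) (ε : ℝ) : Prop := (∑' i, ‖x i - z i‖ ^ q) < ε

/-- `T` is hypercyclic on the space given by membership predicate `mem` with
distance predicate `dlt`: some `x` in the space has dense orbit. -/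
def HypercyclicOn (mem : (ℕ → ℂ) → Prop) (dlt : (ℕ → ℂ) → (ℕ → ℂ) → ℝ → Prop)
    (T : (ℕ → ℂ) → (ℕ → ℂ)) : Prop :=
  ∃ x, mem x ∧ ∀ z, mem z → ∀ ε : ℝ, 0 < ε → ∃ n : ℕ, dlt (T^[n] x) z ε

/-- `T` is supercyclic on the space given by membership predicate `mem` with
distance predicate `dlt`: some `x` in the space has dense projective orbit. -/
def SupercyclicOn (mem : (ℕ → ℂ) → Prop) (dlt : (ℕ → ℂ) → (ℕ → ℂ) → ℝ → Prop)
    (T : (ℕ → ℂ) → (ℕ → ℂ)) : Prop :=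
  ∃ x, mem x ∧ ∀ z, mem z → ∀ ε : ℝ, 0 < ε →
    ∃ (lam : ℂ) (n : ℕ), dlt (fun i => lam * T^[n] x i) z ε

/-- `T` is frequently hypercyclic: some `x` in the space is such that for every ball
(center `z` in the space, radius `ε`), the set of times `n` with `T^[n] x` in the ball
has positive lower density. -/
def FreqHypercyclicOn (mem : (ℕ → ℂ) → Prop) (dlt : (ℕ → ℂ) → (ℕ → ℂ) → ℝ → Prop)
    (T : (ℕ → ℂ) → (ℕ → ℂ)) : Prop :=
  ∃ x, mem x ∧ ∀ z, mem z → ∀ ε : ℝ, 0 < ε →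
    0 < Filter.liminf (fun N : ℕ =>
      (({n : ℕ | dlt (T^[n] x) z ε} ∩ Set.Icc 1 N).ncard : ℝ) / (N : ℝ)) Filter.atTop

/-- `T` is Devaney chaotic: it is hypercyclic, its periodic points are dense, and it has
sensitive dependence on initial conditions. -/
def DevaneyOn (mem : (ℕ → ℂ) → Prop) (dlt : (ℕ → ℂ) → (ℕ → ℂ) → ℝ → Prop)
    (T : (ℕ → ℂ) → (ℕ → ℂ)) : Prop :=
  HypercyclicOn mem dlt T ∧
  (∀ z, mem z → ∀ ε : ℝ, 0 < ε →
    ∃ y, mem y ∧ (∃ n : ℕ, 1 ≤ n ∧ T^[n] y = y) ∧ dlt y z ε) ∧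
  (∃ δ : ℝ, 0 < δ ∧ ∀ x, mem x → ∀ ε : ℝ, 0 < ε →
    ∃ y, mem y ∧ dlt x y ε ∧ ∃ n : ℕ, ¬ dlt (T^[n] x) (T^[n] y) δ)

section SeparatedTimes

/-- The position of the `j`-th block in a sequence of times whose consecutive gaps dominate the
`2`-adic valuations of the neighbouring indices. -/
def blockTime (j : ℕ) : ℕ := ∑ i ∈ Finset.Ico 1 j, (padicValNat 2 i + padicValNat 2 (i + 1))

lemma blockTime_succ {j : ℕ} (hj : 1 ≤ j) :
    blockTime (j + 1) = blockTime j + (padicValNat 2 j + padicValNat 2 (j + 1)) := by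
  unfold blockTime
  rw [Finset.sum_Ico_succ_top hj]

lemma one_le_padicValNat_two_add (j : ℕ) (hj : 1 ≤ j) :
    1 ≤ padicValNat 2 j + padicValNat 2 (j + 1) := by
  rcases Nat.even_or_odd' j with ⟨k, rfl | rfl⟩
  · have := one_le_padicValNat_of_dvd (p := 2) (n := 2 * k) (by omega) ⟨k, rfl⟩
    omega
  · have := one_le_padicValNat_of_dvd (p := 2) (n := 2 * k + 1 + 1) (by omega) ⟨k + 1, by ring⟩
    omega

lemma blockTime_add_le {j : ℕ} (hj : 1 ≤ j) (k : ℕ) :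
    blockTime j + k ≤ blockTime (j + k) := by
  induction k with
  | zero => simp
  | succ k ih =>
    have h1 := blockTime_succ (j := j + k) (by omega)
    have h2 := one_le_padicValNat_two_add (j + k) (by omega)
    rw [← add_assoc, ← add_assoc, h1]
    omega

lemma blockTime_add_padicValNat_le {j k : ℕ} (hj : 1 ≤ j) (hjk : j < k) :
    blockTime j + padicValNat 2 j ≤ blockTime k ∧ blockTime j + padicValNat 2 k ≤ blockTime k := by
  constructor
  · have h1 := blockTime_succ hj
    have h2 := blockTime_add_le (j := j + 1) (by omega) (k - (j + 1))
    rw [show j + 1 + (k - (j + 1)) = k by omega] at h2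
    omega
  · obtain ⟨m, rfl⟩ : ∃ m, k = m + 1 := ⟨k - 1, by omega⟩
    have h1 := blockTime_succ (j := m) (by omega)
    have h2 := blockTime_add_le hj (m - j)
    rw [show j + (m - j) = m by omega] at h2
    omega

lemma sum_padicValNat_two_le (n : ℕ) : ∑ i ∈ Finset.Ico 1 (n + 1), padicValNat 2 i ≤ n := by
  have h : ∑ i ∈ Finset.Ico 1 (n + 1), padicValNat 2 i = padicValNat 2 n.factorial := by
    induction n with
    | zero => simp
    | succ n ih =>
      rw [Finset.sum_Ico_succ_top (by omega), ih, Nat.factorial_succ,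
        padicValNat.mul (by omega) (Nat.factorial_ne_zero n), add_comm]
  have := sub_one_mul_padicValNat_factorial (p := 2) n
  omega

lemma blockTime_le (j : ℕ) : blockTime j ≤ 2 * j := by
  rcases Nat.eq_zero_or_pos j with rfl | hj
  · simp [blockTime]
  obtain ⟨m, rfl⟩ : ∃ m, j = m + 1 := ⟨j - 1, by omega⟩
  unfold blockTime
  rw [Finset.sum_add_distrib]
  have h1 := sum_padicValNat_two_le m
  have h2 := sum_padicValNat_two_le (m + 1)
  rw [Finset.sum_Ico_add' (fun i => padicValNat 2 i) 1 (m + 1) 1]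
  have h3 : ∑ i ∈ Finset.Ico (1 + 1) (m + 1 + 1), padicValNat 2 i
      ≤ ∑ i ∈ Finset.Ico 1 (m + 1 + 1), padicValNat 2 i :=
    Finset.sum_le_sum_of_subset (Finset.Ico_subset_Ico_left (by omega))
  omega

lemma padicValNat_two_pow_mul_odd (l i : ℕ) : padicValNat 2 (2 ^ l * (2 * i + 1)) = l := by
  rw [padicValNat.mul (by positivity) (by omega), padicValNat.prime_pow,
    padicValNat.eq_zero_of_not_dvd (by omega), add_zero]

/-- A set of times containing `blockTime j` for every `j` of `2`-adic valuation `l` has positive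
lower density. -/
lemma liminf_density_pos {A : Set ℕ} {l : ℕ}
    (hA : ∀ j, 1 ≤ j → padicValNat 2 j = l → blockTime j ∈ A) :
    0 < Filter.liminf (fun N : ℕ => ((A ∩ Set.Icc 1 N).ncard : ℝ) / (N : ℝ)) Filter.atTop := by
  set C : ℕ := 2 ^ l * 8 with hC
  have hC8 : 8 ≤ C := by
    have : 1 ≤ 2 ^ l := Nat.one_le_two_pow
    omega
  have key : ∀ M N : ℕ, C * M + C ≤ N → M ≤ (A ∩ Set.Icc 1 N).ncard := by
    intro M N h
    have hinj : Function.Injective fun i : ℕ => blockTime (2 ^ l * (2 * (i + 1) + 1)) := by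
      apply StrictMono.injective
      apply strictMono_nat_of_lt_succ
      intro i
      have hpos : 1 ≤ 2 ^ l := Nat.one_le_two_pow
      have h1 := blockTime_add_le (j := 2 ^ l * (2 * (i + 1) + 1)) (by nlinarith) (2 ^ l * 2)
      have h2 : 2 ^ l * (2 * (i + 1) + 1) + 2 ^ l * 2 = 2 ^ l * (2 * (i + 1 + 1) + 1) := by ring
      rw [h2] at h1
      show blockTime _ < blockTime _
      omega
    have hsub : (Finset.image (fun i : ℕ => blockTime (2 ^ l * (2 * (i + 1) + 1)))
        (Finset.range M) : Set ℕ) ⊆ A ∩ Set.Icc 1 N := by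
      intro n hn
      simp only [Finset.coe_image, Finset.coe_range, Set.mem_image, Set.mem_Iio] at hn
      obtain ⟨i, hi, rfl⟩ := hn
      have hpos : 1 ≤ 2 ^ l := Nat.one_le_two_pow
      have hone : 3 ≤ 2 ^ l * (2 * (i + 1) + 1) := by nlinarith
      refine ⟨hA _ (by omega) (padicValNat_two_pow_mul_odd _ _), ?_, ?_⟩
      · have := blockTime_add_le (j := 1) le_rfl (2 ^ l * (2 * (i + 1) + 1) - 1)
        rw [show 1 + (2 ^ l * (2 * (i + 1) + 1) - 1) = 2 ^ l * (2 * (i + 1) + 1) by omega] at this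
        omega
      · refine (blockTime_le _).trans (le_trans ?_ h)
        rw [hC]
        nlinarith
    have hfin : (A ∩ Set.Icc 1 N).Finite := (Set.finite_Icc 1 N).inter_of_right A
    have := Set.ncard_le_ncard hsub hfin
    rwa [Set.ncard_coe_finset, Finset.card_image_of_injective _ hinj, Finset.card_range] at this
  have hlow : ∀ᶠ N : ℕ in atTop, (1 / (2 * C) : ℝ) ≤ ((A ∩ Set.Icc 1 N).ncard : ℝ) / (N : ℝ) := by
    filter_upwards [eventually_ge_atTop (4 * C)] with N hN
    have hN0 : (0 : ℝ) < N := by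
      have : 0 < N := by omega
      exact_mod_cast this
    have hC0 : (0 : ℝ) < C := by
      have : 0 < C := by omega
      exact_mod_cast this
    have hmod := Nat.div_add_mod N C
    have hlt := Nat.mod_lt N (show 0 < C by omega)
    have h4 : 4 ≤ N / C := (Nat.le_div_iff_mul_le (by omega)).2 hN
    have h1 := key (N / C - 1) N (by
      calc C * (N / C - 1) + C = C * (N / C - 1 + 1) := by ring
        _ = C * (N / C) := by rw [Nat.sub_add_cancel (by omega)]
        _ ≤ N := by omega)
    have h2 : N ≤ 2 * C * (A ∩ Set.Icc 1 N).ncard := by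
      calc N ≤ C * (N / C) + C := by omega
        _ = C * (N / C + 1) := by ring
        _ ≤ C * (2 * (N / C - 1)) := Nat.mul_le_mul_left _ (by omega)
        _ = 2 * C * (N / C - 1) := by ring
        _ ≤ _ := Nat.mul_le_mul_left _ h1
    rw [div_le_div_iff₀ (by positivity) hN0]
    have h3 : (N : ℝ) ≤ 2 * C * ((A ∩ Set.Icc 1 N).ncard : ℝ) := by exact_mod_cast h2
    linarith
  refine lt_of_lt_of_le (b := (1 / (2 * C) : ℝ)) ?_ (Filter.le_liminf_of_le ?_ hlow)
  · have : (0 : ℝ) < C := by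
      have : 0 < C := by omega
      exact_mod_cast this
    positivity
  · refine Filter.IsBoundedUnder.isCoboundedUnder_ge ⟨1, ?_⟩
    simp only [Filter.eventually_map]
    refine Filter.Eventually.of_forall fun N => ?_
    refine div_le_one_of_le₀ ?_ (by positivity)
    have := Set.ncard_le_ncard (Set.inter_subset_right (s := A) (t := Set.Icc 1 N))
      (Set.finite_Icc 1 N)
    rw [show (Set.Icc 1 N).ncard = N by
      rw [Set.ncard_eq_toFinset_card', Set.toFinset_Icc, Nat.card_Icc]; omega] at this
    exact_mod_cast this

end SeparatedTimes

section Criterion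

variable {X : Type*} [NormedAddCommGroup X] [NormedSpace ℂ X] {T S : X →L[ℂ] X} {u : X}

lemma pow_apply_pow_apply_of_le (hTS : ∀ x, T (S x) = x) {n m : ℕ} (h : n ≤ m) (x : X) :
    (T ^ n) ((S ^ m) x) = (S ^ (m - n)) x := by
  induction n generalizing m with
  | zero => simp
  | succ n ih =>
    obtain ⟨m, rfl⟩ : ∃ k, m = k + 1 := ⟨m - 1, by omega⟩
    rw [pow_succ, pow_succ', mul_apply_eq_comp, mul_apply_eq_comp, hTS,
      ih (by omega)]
    simp

lemma pow_apply_pow_apply_of_ge (hTS : ∀ x, T (S x) = x) {n m : ℕ} (h : m ≤ n) (x : X) :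
    (T ^ n) ((S ^ m) x) = (T ^ (n - m)) x := by
  obtain ⟨k, rfl⟩ := Nat.exists_eq_add_of_le h
  rw [add_comm m k, pow_add, mul_apply_eq_comp, pow_apply_pow_apply_of_le hTS le_rfl]
  simp

lemma norm_pow_apply_le_of_norm_le (hS : ‖S‖ ≤ 1 / 4) (n : ℕ) (x : X) :
    ‖(S ^ n) x‖ ≤ (1 / 4) ^ n * ‖x‖ := by
  induction n with
  | zero => simp
  | succ n ih =>
    rw [pow_succ', mul_apply_eq_comp, pow_succ', mul_assoc]
    exact S.le_of_opNorm_le_of_le hS ih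

lemma exists_pow_apply_eq_zero (hTS : ∀ x, T (S x) = x) (hTu : T u = 0) {x : X}
    (hx : x ∈ Submodule.span ℂ (Set.range fun k : ℕ => (S ^ k) u)) :
    ∃ d, ∀ n, d ≤ n → (T ^ n) x = 0 := by
  induction hx using Submodule.span_induction with
  | mem x hx =>
    obtain ⟨k, rfl⟩ := hx
    refine ⟨k + 1, fun n hn => ?_⟩
    obtain ⟨m, rfl⟩ := Nat.exists_eq_add_of_le hn
    simp only
    rw [pow_apply_pow_apply_of_ge hTS (by omega), show k + 1 + m - k = m + 1 by omega, pow_succ,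
      mul_apply_eq_comp, hTu, map_zero]
  | zero => exact ⟨0, by simp⟩
  | add x y _ _ hx hy =>
    obtain ⟨d, hd⟩ := hx
    obtain ⟨e, he⟩ := hy
    exact ⟨max d e, fun n hn => by
      rw [map_add, hd n (le_of_max_le_left hn), he n (le_of_max_le_right hn), add_zero]⟩
  | smul a x _ hx =>
    obtain ⟨d, hd⟩ := hx
    exact ⟨d, fun n hn => by rw [map_smul, hd n hn, smul_zero]⟩

/-- A sequence of vectors killed by powers of `T`, growing slowly, and visiting every ball
infinitely often. -/
lemma exists_slow_dense_seq (hTS : ∀ x, T (S x) = x) (hTu : T u = 0)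
    (hdense : Dense (Submodule.span ℂ (Set.range fun k : ℕ => (S ^ k) u) : Set X)) :
    ∃ y : ℕ → X, (∀ l n, l ≤ n → (T ^ n) (y l) = 0) ∧ (∀ l, ‖y l‖ ≤ 2 ^ l) ∧
      ∀ z, ∀ ε : ℝ, 0 < ε → ∀ L, ∃ l, L ≤ l ∧ ‖y l - z‖ < ε := by
  classical
  have hsep : TopologicalSpace.IsSeparable
      (Submodule.span ℂ (Set.range fun k : ℕ => (S ^ k) u) : Set X) :=
    (Set.countable_range _).isSeparable.span
  obtain ⟨t, hts, htc, hst⟩ := hsep.exists_countable_dense_subset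
  have htd : Dense t := fun x => by
    have : x ∈ closure (closure t) := closure_mono hst (hdense x)
    rwa [closure_closure] at this
  obtain ⟨g, rfl⟩ := htc.exists_eq_range htd.nonempty
  choose d hd using fun a => exists_pow_apply_eq_zero hTS hTu (hts ⟨a, rfl⟩ : g a ∈ _)
  refine ⟨fun l => if d l.unpair.1 ≤ l ∧ ‖g l.unpair.1‖ ≤ 2 ^ l then g l.unpair.1 else 0,
    fun l n hn => ?_, fun l => ?_, fun z ε hε L => ?_⟩
  · dsimp only
    split_ifs with h
    · exact hd _ _ (h.1.trans hn)
    · simp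
  · dsimp only
    split_ifs with h
    · exact h.2
    · simp
  · obtain ⟨x, ⟨a, rfl⟩, hx⟩ := htd.exists_dist_lt z hε
    rw [dist_comm] at hx
    obtain ⟨b, hb⟩ := pow_unbounded_of_one_lt ‖g a‖ (one_lt_two (α := ℝ))
    set k := max (max (d a) b) L
    have hk : k ≤ Nat.pair a k := Nat.right_le_pair a k
    refine ⟨Nat.pair a k, (le_max_right _ _).trans hk, ?_⟩
    simp only [Nat.unpair_pair]
    rw [if_pos]
    · simpa [dist_eq_norm] using hx
    · refine ⟨((le_max_left _ _).trans (le_max_left _ _)).trans hk, hb.le.trans ?_⟩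
      exact pow_le_pow_right₀ one_le_two (((le_max_right _ _).trans (le_max_left _ _)).trans hk)

/-- The frequent hypercyclicity criterion for an operator with a strongly contracting right
inverse and a dense generalized kernel. -/
lemma exists_freqHypercyclic_vector [CompleteSpace X] (hTS : ∀ x, T (S x) = x) (hTu : T u = 0)
    (hS : ‖S‖ ≤ 1 / 4)
    (hdense : Dense (Submodule.span ℂ (Set.range fun k : ℕ => (S ^ k) u) : Set X)) :
    ∃ x : X, ∀ z, ∀ ε : ℝ, 0 < ε → ∃ l, ∀ j, 1 ≤ j → padicValNat 2 j = l →
      ‖(T ^ blockTime j) x - z‖ < ε := by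
  obtain ⟨y, hy0, hyn, hyd⟩ := exists_slow_dense_seq hTS hTu hdense
  set F : ℕ → X := fun i => (S ^ blockTime (i + 1)) (y (padicValNat 2 (i + 1))) with hF
  have hbound : ∀ (n l : ℕ), l ≤ n → ‖(S ^ n) (y l)‖ ≤ (1 / 2) ^ n := by
    intro n l hl
    refine (norm_pow_apply_le_of_norm_le hS n _).trans ?_
    calc (1 / 4 : ℝ) ^ n * ‖y l‖ ≤ (1 / 4) ^ n * 2 ^ n := by
          gcongr
          exact (hyn l).trans (pow_le_pow_right₀ one_le_two hl)
      _ = (1 / 2) ^ n := by rw [← mul_pow]; norm_num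
  have hFs : Summable F := by
    refine Summable.of_norm_bounded (g := fun i => (1 / 2 : ℝ) ^ i) summable_geometric_two
      fun i => ?_
    have h1 := blockTime_add_le (j := 1) le_rfl i
    rw [add_comm 1 i] at h1
    refine (hbound _ _ ?_).trans (pow_le_pow_of_le_one (by norm_num) (by norm_num) (by omega))
    rcases Nat.eq_zero_or_pos i with rfl | hi
    · simp
    · have := (blockTime_add_padicValNat_le (j := 1) (k := i + 1) le_rfl (by omega)).2
      omega
  refine ⟨∑' i, F i, fun z ε hε => ?_⟩
  obtain ⟨L, hL⟩ := exists_pow_lt_of_lt_one (show 0 < ε / 4 by positivity)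
    (show (1 / 2 : ℝ) < 1 by norm_num)
  obtain ⟨l, hLl, hl⟩ := hyd z (ε / 2) (by positivity) L
  refine ⟨l, fun j hj hjl => ?_⟩
  obtain ⟨J, rfl⟩ : ∃ J, j = J + 1 := ⟨j - 1, by omega⟩
  have hmap : (T ^ blockTime (J + 1)) (∑' i, F i) = ∑' i, (T ^ blockTime (J + 1)) (F i) :=
    ContinuousLinearMap.map_tsum _ hFs
  have hsum' : Summable fun i => (T ^ blockTime (J + 1)) (F i) :=
    hFs.mapL _
  have hlt : ∀ i ∈ Finset.range J, (T ^ blockTime (J + 1)) (F i) = 0 := by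
    intro i hi
    have hi := Finset.mem_range.1 hi
    have h1 := (blockTime_add_padicValNat_le (j := i + 1) (k := J + 1) (by omega) (by omega)).1
    rw [hF, pow_apply_pow_apply_of_ge hTS (by omega)]
    exact hy0 _ _ (by omega)
  have hmid : (T ^ blockTime (J + 1)) (F J) = y l := by
    rw [hF, pow_apply_pow_apply_of_le hTS le_rfl, hjl]
    simp
  have htail : ∀ i, ‖(T ^ blockTime (J + 1)) (F (i + (J + 1)))‖ ≤ (1 / 2) ^ L * (1 / 2) ^ i := by
    intro i
    have h1 := blockTime_add_padicValNat_le (j := J + 1) (k := i + (J + 1) + 1)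
      (by omega) (by omega)
    have h2 := (blockTime_add_padicValNat_le (j := J + 1) (k := J + 1 + 1)
      (by omega) (by omega)).1
    have h3 := blockTime_add_le (j := J + 1 + 1) (by omega) i
    rw [show J + 1 + 1 + i = i + (J + 1) + 1 by ring] at h3
    rw [hF, pow_apply_pow_apply_of_le hTS (by omega), ← pow_add]
    exact (hbound _ _ (by omega)).trans
      (pow_le_pow_of_le_one (by norm_num) (by norm_num) (by omega))
  have heq : (T ^ blockTime (J + 1)) (∑' i, F i)
      = y l + ∑' i, (T ^ blockTime (J + 1)) (F (i + (J + 1))) := by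
    rw [hmap, ← hsum'.sum_add_tsum_nat_add (J + 1), Finset.sum_range_succ,
      Finset.sum_eq_zero hlt, hmid, zero_add]
  have htsum : ‖∑' i, (T ^ blockTime (J + 1)) (F (i + (J + 1)))‖ ≤ (1 / 2) ^ L * 2 :=
    tsum_of_norm_bounded (hasSum_geometric_two.mul_left _) htail
  rw [heq, add_sub_right_comm]
  refine (norm_add_le _ _).trans_lt ?_
  linarith

/-- Density of periodic points for an operator with a strongly contracting right inverse and a
dense generalized kernel. -/
lemma exists_periodic_near [CompleteSpace X] (hTS : ∀ x, T (S x) = x) (hTu : T u = 0)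
    (hS : ‖S‖ ≤ 1 / 4)
    (hdense : Dense (Submodule.span ℂ (Set.range fun k : ℕ => (S ^ k) u) : Set X))
    (z : X) {ε : ℝ} (hε : 0 < ε) :
    ∃ y : X, (∃ n : ℕ, 1 ≤ n ∧ (T ^ n) y = y) ∧ ‖y - z‖ < ε := by
  obtain ⟨x, hx, hxz⟩ := hdense.exists_dist_lt z (half_pos hε)
  obtain ⟨d, hd⟩ := exists_pow_apply_eq_zero hTS hTu hx
  obtain ⟨L, hL⟩ := exists_pow_lt_of_lt_one (show 0 < ε / (2 * (2 * (‖x‖ + 1))) by positivity)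
    (show (1 / 4 : ℝ) < 1 by norm_num)
  set n := max d L + 1 with hn
  have hbd : ∀ k, ‖(S ^ (n * (k + 1))) x‖ ≤ ((1 / 4) ^ L * ‖x‖) * (1 / 2) ^ k := by
    intro k
    refine (norm_pow_apply_le_of_norm_le hS _ x).trans ?_
    have h1 : (1 / 4 : ℝ) ^ (n * (k + 1)) ≤ (1 / 4) ^ (L + k) := by
      refine pow_le_pow_of_le_one (by norm_num) (by norm_num) ?_
      have : L + 1 ≤ n := by omega
      nlinarith
    have h2 : (1 / 4 : ℝ) ^ k ≤ (1 / 2) ^ k := by gcongr; norm_num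
    calc (1 / 4 : ℝ) ^ (n * (k + 1)) * ‖x‖ ≤ (1 / 4) ^ (L + k) * ‖x‖ := by gcongr
      _ = (1 / 4) ^ L * ‖x‖ * (1 / 4) ^ k := by rw [pow_add]; ring
      _ ≤ _ := by gcongr
  have hs1 : Summable fun k => (S ^ (n * (k + 1))) x :=
    Summable.of_norm_bounded (summable_geometric_two.mul_left _) hbd
  have hs : Summable fun k => (S ^ (n * k)) x := (summable_nat_add_iff 1).1 hs1
  have hsplit : ∑' k, (S ^ (n * k)) x = x + ∑' k, (S ^ (n * (k + 1))) x := by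
    rw [hs.tsum_eq_zero_add]
    simp
  refine ⟨∑' k, (S ^ (n * k)) x, ⟨n, by omega, ?_⟩, ?_⟩
  · conv_lhs => rw [hsplit, map_add, hd n (by omega), zero_add, ContinuousLinearMap.map_tsum _ hs1]
    refine tsum_congr fun k => ?_
    rw [pow_apply_pow_apply_of_le hTS (by nlinarith)]
    congr 2
    rw [mul_add, mul_one, Nat.add_sub_cancel]
  · have h1 : ‖∑' k, (S ^ (n * (k + 1))) x‖ ≤ ((1 / 4) ^ L * ‖x‖) * 2 :=
      tsum_of_norm_bounded (hasSum_geometric_two.mul_left _) hbd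
    have h2 : ((1 / 4 : ℝ) ^ L * ‖x‖) * 2 ≤ ε / 2 := by
      have h3 : (1 / 4 : ℝ) ^ L * (2 * (‖x‖ + 1)) ≤ ε / 2 := by
        rw [← le_div_iff₀ (by positivity), div_div]
        exact hL.le
      have h4 : (0 : ℝ) ≤ (1 / 4) ^ L := by positivity
      nlinarith
    rw [hsplit, add_sub_right_comm]
    refine (norm_add_le _ _).trans_lt ?_
    rw [dist_comm, dist_eq_norm] at hxz
    linarith

variable {c : X →ₗ[ℂ] (ℕ → ℂ)} {mem : (ℕ → ℂ) → Prop} {dlt : (ℕ → ℂ) → (ℕ → ℂ) → ℝ → Prop}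
  {f : (ℕ → ℂ) → (ℕ → ℂ)}

lemma iterate_apply_eq_pow (hf : ∀ x, f (c x) = c (T x)) (n : ℕ) (x : X) :
    f^[n] (c x) = c ((T ^ n) x) := by
  induction n generalizing x with
  | zero => simp
  | succ n ih => rw [Function.iterate_succ_apply, hf, ih, pow_succ, mul_apply_eq_comp]

lemma FreqHypercyclicOn.hypercyclicOn (h : FreqHypercyclicOn mem dlt f) :
    HypercyclicOn mem dlt f := by
  obtain ⟨x, hx, h⟩ := h
  refine ⟨x, hx, fun z hz ε hε => ?_⟩
  by_contra! hne
  have := h z hz ε hε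
  simp [hne] at this

/-- Transfer of the criterion to a sequence space realised as the range of `c`. -/
theorem freqHypercyclicOn_and_devaneyOn [CompleteSpace X] (hTS : ∀ x, T (S x) = x) (hTu : T u = 0)
    (hS : ‖S‖ ≤ 1 / 4)
    (hdense : Dense (Submodule.span ℂ (Set.range fun k : ℕ => (S ^ k) u) : Set X))
    (hu : c u 0 = 1) (hf : ∀ x, f (c x) = c (T x))
    (hmem : ∀ x, mem x ↔ ∃ y, c y = x)
    (hdlt : ∀ ε : ℝ, 0 < ε → ∃ η : ℝ, 0 < η ∧ ∀ x y, ‖x - y‖ < η → dlt (c x) (c y) ε)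
    (hndlt : ∀ x y, 1 ≤ ‖c x 0 - c y 0‖ → ¬ dlt (c x) (c y) 1) :
    FreqHypercyclicOn mem dlt f ∧ DevaneyOn mem dlt f := by
  have hfreq : FreqHypercyclicOn mem dlt f := by
    obtain ⟨x, hx⟩ := exists_freqHypercyclic_vector hTS hTu hS hdense
    refine ⟨c x, (hmem _).2 ⟨x, rfl⟩, fun z hz ε hε => ?_⟩
    obtain ⟨z, rfl⟩ := (hmem _).1 hz
    obtain ⟨η, hη, hdη⟩ := hdlt ε hε
    obtain ⟨l, hl⟩ := hx z η hη
    refine liminf_density_pos (l := l) fun j hj hjl => ?_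
    rw [Set.mem_ofPred_eq, iterate_apply_eq_pow hf]
    exact hdη _ _ (hl j hj hjl)
  refine ⟨hfreq, hfreq.hypercyclicOn, fun z hz ε hε => ?_, 1, one_pos, fun x hx ε hε => ?_⟩
  · obtain ⟨z, rfl⟩ := (hmem _).1 hz
    obtain ⟨η, hη, hdη⟩ := hdlt ε hε
    obtain ⟨y, ⟨n, hn, hny⟩, hy⟩ := exists_periodic_near hTS hTu hS hdense z hη
    exact ⟨c y, (hmem _).2 ⟨y, rfl⟩, ⟨n, hn, by rw [iterate_apply_eq_pow hf, hny]⟩, hdη _ _ hy⟩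
  · obtain ⟨x, rfl⟩ := (hmem _).1 hx
    obtain ⟨η, hη, hdη⟩ := hdlt ε hε
    obtain ⟨n, hn⟩ := exists_pow_lt_of_lt_one (show 0 < η / (‖u‖ + 1) by positivity)
      (show (1 / 4 : ℝ) < 1 by norm_num)
    refine ⟨c (x + (S ^ n) u), (hmem _).2 ⟨_, rfl⟩, hdη _ _ ?_, n, ?_⟩
    · rw [sub_add_cancel_left, norm_neg]
      refine (norm_pow_apply_le_of_norm_le hS n u).trans_lt ?_
      rw [lt_div_iff₀ (by positivity)] at hn
      have : (0 : ℝ) ≤ (1 / 4) ^ n := by positivity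
      nlinarith
    · rw [iterate_apply_eq_pow hf, iterate_apply_eq_pow hf]
      refine hndlt _ _ ?_
      rw [map_add, pow_apply_pow_apply_of_le hTS le_rfl, Nat.sub_self, pow_zero,
        one_apply_eq_self, map_add, Pi.add_apply, sub_add_cancel_left, norm_neg, hu,
        norm_one]

end Criterion

section Recursion

/-- The solution `x` of `G x = z x + y` with `x 0 = a`. -/
noncomputable def walkSolve (p : ℕ → ℝ) (z : ℝ) (y : ℕ → ℝ) (a : ℝ) : ℕ → ℝ
  | 0 => a
  | 1 => (y 0 + (z - (1 - p 0)) * a) / p 0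
  | i + 2 => (y (i + 1) + z * walkSolve p z y a (i + 1)
      - (1 - p (i + 1)) * walkSolve p z y a i) / p (i + 1)

variable {p : ℕ → ℝ}

lemma walkSolve_spec (hp : ∀ n, 0 < p n) (z : ℝ) (y : ℕ → ℝ) (a : ℝ) (i : ℕ) :
    (1 - p i) * walkSolve p z y a (i - 1) + p i * walkSolve p z y a (i + 1)
      = z * walkSolve p z y a i + y i := by
  rcases i with _ | i
  · have := (hp 0).ne'
    simp only [Nat.zero_sub, walkSolve]
    field_simp
    ring
  · have := (hp (i + 1)).ne'
    rw [Nat.add_sub_cancel, walkSolve]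
    field_simp
    ring

/-- A quantity which never grows by more than a factor `B`, and which decays geometrically over
two steps after time `n0`, decays geometrically. -/
lemma le_geometric_of_two_step {f : ℕ → ℝ} {B μ : ℝ} {n0 : ℕ} (hf : ∀ n, 0 ≤ f n) (hB : 1 ≤ B)
    (hμ0 : 0 < μ) (hμ1 : μ ≤ 1) (h1 : ∀ n, f (n + 1) ≤ B * f n)
    (h2 : ∀ n, n0 ≤ n → f (n + 1) ≤ f n) (h3 : ∀ n, n0 ≤ n → f (n + 2) ≤ μ ^ 2 * f n) (n : ℕ) :
    f n * μ ^ (n0 + 1) ≤ B ^ n0 * μ ^ n * f 0 := by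
  have hB' : ∀ n, f n ≤ B ^ n * f 0 := by
    intro n
    induction n with
    | zero => simp
    | succ n ih =>
      calc f (n + 1) ≤ B * f n := h1 n
        _ ≤ B * (B ^ n * f 0) := by gcongr
        _ = _ := by ring
  rcases le_total n n0 with hn | hn
  · calc f n * μ ^ (n0 + 1) ≤ (B ^ n * f 0) * μ ^ n :=
          mul_le_mul (hB' n) (pow_le_pow_of_le_one hμ0.le hμ1 (by omega)) (by positivity)
            (mul_nonneg (by positivity) (hf 0))
      _ ≤ (B ^ n0 * f 0) * μ ^ n := by
          gcongr
          exact hf 0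
      _ = _ := by ring
  · obtain ⟨k, rfl⟩ := Nat.exists_eq_add_of_le hn
    have hk : ∀ k, f (n0 + k) * μ ≤ μ ^ k * f n0 ∧ f (n0 + (k + 1)) * μ ≤ μ ^ (k + 1) * f n0 := by
      intro k
      induction k with
      | zero =>
        have := h2 n0 le_rfl
        have := hf n0
        constructor
        · simp only [add_zero, pow_zero]; nlinarith
        · simp only [zero_add, pow_one]; nlinarith
      | succ k ih =>
        refine ⟨ih.2, ?_⟩
        calc f (n0 + (k + 1 + 1)) * μ ≤ μ ^ 2 * f (n0 + k) * μ := by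
              gcongr
              exact h3 (n0 + k) (by omega)
          _ = μ ^ 2 * (f (n0 + k) * μ) := by ring
          _ ≤ μ ^ 2 * (μ ^ k * f n0) := mul_le_mul_of_nonneg_left ih.1 (by positivity)
          _ = _ := by ring
    calc f (n0 + k) * μ ^ (n0 + 1) = (f (n0 + k) * μ) * μ ^ n0 := by ring
      _ ≤ (μ ^ k * (B ^ n0 * f 0)) * μ ^ n0 :=
          mul_le_mul_of_nonneg_right
            ((hk k).1.trans (mul_le_mul_of_nonneg_left (hB' n0) (by positivity))) (by positivity)
      _ = _ := by rw [pow_add]; ring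

lemma exists_lower_bound (hp : ∀ n, 0 < p n) {n0 : ℕ} {b : ℝ} (hb : 0 < b)
    (hge : ∀ n, n0 ≤ n → b ≤ p n) : ∃ m, 0 < m ∧ ∀ n, m ≤ p n := by
  induction n0 generalizing b with
  | zero => exact ⟨b, hb, fun n => hge n (Nat.zero_le n)⟩
  | succ k ih =>
    refine ih (lt_min hb (hp k)) fun n hn => ?_
    rcases hn.eq_or_lt with rfl | hn
    · exact min_le_right _ _
    · exact (min_le_left _ _).trans (hge n hn)

lemma energy_le {z r e b : ℝ} (hz : z ^ 2 ≤ 1) (hr : r ^ 2 ≤ 1) :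
    (1 - z ^ 2) * (e ^ 2 + (1 - z ^ 2) * b ^ 2)
      ≤ 3 * (e ^ 2 + ((1 - z ^ 2) * b + z * r * e) ^ 2) := by
  have hz0 : 0 ≤ z ^ 2 := sq_nonneg z
  have hzr : z ^ 2 * r ^ 2 ≤ 1 := mul_le_one₀ hz (sq_nonneg r) hr
  have h1 : ((1 - z ^ 2) * b) ^ 2 ≤ 2 * ((1 - z ^ 2) * b + z * r * e) ^ 2
      + 2 * (z * r * e) ^ 2 := by
    linarith [sq_nonneg ((1 - z ^ 2) * b + 2 * (z * r * e))]
  have h2 : (z * r * e) ^ 2 ≤ e ^ 2 := by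
    have : (z * r * e) ^ 2 = (z ^ 2 * r ^ 2) * e ^ 2 := by ring
    rw [this]
    exact mul_le_of_le_one_left (sq_nonneg e) hzr
  have h3 : 0 ≤ z ^ 2 * e ^ 2 := by positivity
  have h4 := sq_nonneg ((1 - z ^ 2) * b + z * r * e)
  linarith

lemma energy_two_step {z ρ R r a b c V₁ V₂ : ℝ} (hz : z ^ 2 ≤ ρ ^ 2) (hρ : 0 ≤ 1 - ρ ^ 2)
    (hR : 0 ≤ 1 - R ^ 2) (hr : r ^ 2 ≤ 1) (hc : c - z * b = r * (z * b - a))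
    (h₁ : V₁ ≤ (a - z * b) ^ 2 + (1 - z ^ 2) * b ^ 2 - (1 - R ^ 2) * (a - z * b) ^ 2)
    (h₂ : V₂ ≤ V₁ - (1 - R ^ 2) * (b - z * c) ^ 2) :
    V₂ ≤ (1 - (1 - R ^ 2) * (1 - ρ ^ 2) / 3) * ((a - z * b) ^ 2 + (1 - z ^ 2) * b ^ 2) := by
  have hlow := energy_le (z := z) (r := r) (e := a - z * b) (b := b) (by linarith) hr
  have he : (1 - z ^ 2) * b + z * r * (a - z * b) = b - z * c := by
    have : c = z * b + r * (z * b - a) := by linarith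
    rw [this]; ring
  rw [he] at hlow
  have hV : 0 ≤ (a - z * b) ^ 2 + (1 - z ^ 2) * b ^ 2 :=
    add_nonneg (sq_nonneg _) (mul_nonneg (by linarith) (sq_nonneg _))
  have h3 := (mul_le_mul_of_nonneg_right (by linarith : 1 - ρ ^ 2 ≤ 1 - z ^ 2) hV).trans hlow
  have := mul_le_mul_of_nonneg_left h3 hR
  linarith

/-- Geometric decay of an energy controlling `x` gives geometric decay of `x`. -/
lemma abs_le_geometric_of_energy {x V : ℕ → ℝ} {A K μ ε ν : ℝ} (hμ : 0 < μ) (hε : 0 < ε)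
    (hν : 0 < ν) (hK : 0 ≤ K) (hV : ∀ n, V n * ν ≤ K * μ ^ n * V 0) (hVA : V 0 ≤ A ^ 2)
    (hA : 0 ≤ A) (hx0 : |x 0| ≤ A) (hx : ∀ n, ε * x (n + 1) ^ 2 ≤ V n) (n : ℕ) :
    |x n| ≤ √(1 + K / (ν * μ * ε)) * √μ ^ n * A := by
  have hq : 0 ≤ K / (ν * μ * ε) := by positivity
  refine abs_le_of_sq_le_sq ?_ (by positivity)
  rw [mul_pow, mul_pow, Real.sq_sqrt (by linarith), ← pow_mul, mul_comm n 2, pow_mul,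
    Real.sq_sqrt hμ.le]
  have hA2 : 0 ≤ A ^ 2 := sq_nonneg A
  rcases n with _ | n
  · have h1 : x 0 ^ 2 ≤ A ^ 2 := by
      rw [← sq_abs]
      exact pow_le_pow_left₀ (abs_nonneg _) hx0 2
    rw [pow_zero, mul_one, add_mul, one_mul]
    exact h1.trans (le_add_of_nonneg_right (mul_nonneg hq hA2))
  · have h2 : x (n + 1) ^ 2 * (ν * ε) ≤ K * μ ^ n * A ^ 2 :=
      calc x (n + 1) ^ 2 * (ν * ε) = ε * x (n + 1) ^ 2 * ν := by ring
        _ ≤ V n * ν := mul_le_mul_of_nonneg_right (hx n) hν.le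
        _ ≤ K * μ ^ n * V 0 := hV n
        _ ≤ _ := mul_le_mul_of_nonneg_left hVA (by positivity)
    have h3 : K / (ν * μ * ε) * μ ^ (n + 1) * A ^ 2 = K * μ ^ n * A ^ 2 / (ν * ε) := by
      field_simp
      ring
    have h4 : x (n + 1) ^ 2 ≤ K / (ν * μ * ε) * μ ^ (n + 1) * A ^ 2 := by
      rw [h3, le_div_iff₀ (by positivity)]
      exact h2
    rw [add_mul, add_mul, one_mul]
    exact h4.trans (le_add_of_nonneg_left (by positivity))

/-- Solutions of the eigenvalue recursion decay geometrically, uniformly for `|z| ≤ ρ < 1`. -/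
lemma exists_decay (hp : ∀ n, 0 < p n ∧ p n < 1) {n0 : ℕ} {α : ℝ} (hα : 0 < α)
    (hge : ∀ n, n0 ≤ n → 1 / 2 + α ≤ p n) {ρ : ℝ} (hρ0 : 0 ≤ ρ) (hρ1 : ρ < 1) :
    ∃ C κ : ℝ, 0 < C ∧ 0 < κ ∧ κ < 1 ∧ ∀ z, |z| ≤ ρ → ∀ (x : ℕ → ℝ) (j : ℕ),
      (∀ i, j ≤ i → (1 - p (i + 1)) * x i + p (i + 1) * x (i + 2) = z * x (i + 1)) →
      ∀ n, |x (j + n)| ≤ C * κ ^ n * (|x j| + |x (j + 1)|) := by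
  obtain ⟨m, hm0, hm⟩ := exists_lower_bound (fun n => (hp n).1) (by linarith : 0 < 1 / 2 + α) hge
  have hm1 : m < 1 := (hm 0).trans_lt (hp 0).2
  have hα2 : α < 1 / 2 := by linarith [hge n0 le_rfl, (hp n0).2]
  set R : ℝ := (1 / 2 - α) / (1 / 2 + α) with hR
  have hR0 : 0 < R := div_pos (by linarith) (by linarith)
  have hR1 : R < 1 := (div_lt_one (by linarith)).2 (by linarith)
  have hr0 : ∀ n, 0 < (1 - p n) / p n := fun n => div_pos (by linarith [(hp n).2]) (hp n).1
  have hrR : ∀ n, n0 ≤ n → (1 - p n) / p n ≤ R := fun n hn => by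
    rw [hR]
    exact div_le_div₀ (by linarith) (by linarith [hge n hn]) (by linarith) (hge n hn)
  have hrm : ∀ n, (1 - p n) / p n ≤ 1 / m := fun n =>
    div_le_div₀ zero_le_one (by linarith [(hp n).1]) hm0 (hm n)
  set θ : ℝ := 1 - (1 - R ^ 2) * (1 - ρ ^ 2) / 3 with hθ
  have hRsq : 0 < 1 - R ^ 2 ∧ 1 - R ^ 2 ≤ 1 := ⟨by nlinarith, by nlinarith⟩
  have hρsq : 0 < 1 - ρ ^ 2 ∧ 1 - ρ ^ 2 ≤ 1 := ⟨by nlinarith, by nlinarith⟩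
  have hθ0 : 0 < θ := by nlinarith [hRsq.1, hRsq.2, hρsq.1, hρsq.2]
  have hθ1 : θ < 1 := by
    have := mul_pos hRsq.1 hρsq.1
    rw [hθ]; linarith
  set μ := √θ with hμ
  have hμ0 : 0 < μ := Real.sqrt_pos.2 hθ0
  have hμ1 : μ < 1 := by rw [hμ, Real.sqrt_lt' one_pos]; linarith
  have hμ2 : μ ^ 2 = θ := Real.sq_sqrt hθ0.le
  set B : ℝ := 1 + (1 / m) ^ 2 with hB
  have hB0 : 0 < B := by rw [hB]; positivity
  refine ⟨√(1 + B ^ n0 / (μ ^ (n0 + 1) * μ * (1 - ρ ^ 2))), √μ, Real.sqrt_pos.2 ?_,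
    Real.sqrt_pos.2 hμ0, by rw [Real.sqrt_lt' one_pos]; linarith, ?_⟩
  · exact add_pos one_pos (div_pos (by positivity) (mul_pos (by positivity) hρsq.1))
  intro z hz x j hx
  have hz2 : z ^ 2 ≤ ρ ^ 2 := sq_le_sq' (abs_le.1 hz).1 (abs_le.1 hz).2
  have hstep : ∀ i, j ≤ i → x (i + 2) - z * x (i + 1)
      = (1 - p (i + 1)) / p (i + 1) * (z * x (i + 1) - x i) := by
    intro i hi
    have h1 := hx i hi
    have h2 := (hp (i + 1)).1.ne'
    field_simp
    linarith
  set V : ℕ → ℝ := fun n => (x (j + n) - z * x (j + n + 1)) ^ 2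
    + (1 - z ^ 2) * x (j + n + 1) ^ 2 with hV
  have hz1 : 0 < 1 - z ^ 2 := by linarith
  have hV0 : ∀ n, 0 ≤ V n := fun n => by positivity
  have hVs : ∀ n, V (n + 1) = ((1 - p (j + n + 1)) / p (j + n + 1)) ^ 2
      * (x (j + n) - z * x (j + n + 1)) ^ 2 + (1 - z ^ 2) * x (j + n + 1) ^ 2 := by
    intro n
    have h1 := hstep (j + n) (by omega)
    have h2 : V (n + 1) = (x (j + n + 2) - z * x (j + n + 1)) ^ 2
        + (1 - z ^ 2) * x (j + n + 1) ^ 2 := by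
      simp only [hV, ← add_assoc]
      ring
    rw [h2, h1]
    ring
  have hVB : ∀ n, V (n + 1) ≤ B * V n := by
    intro n
    have h1 : ((1 - p (j + n + 1)) / p (j + n + 1)) ^ 2 ≤ (1 / m) ^ 2 :=
      pow_le_pow_left₀ (hr0 _).le (hrm _) 2
    rw [hVs, hB]
    have h2 := sq_nonneg (x (j + n) - z * x (j + n + 1))
    have h3 : 0 ≤ (1 - z ^ 2) * x (j + n + 1) ^ 2 := by positivity
    have h4 : 0 ≤ (1 / m) ^ 2 := by positivity
    simp only [hV]
    nlinarith
  have hVd : ∀ n, n0 ≤ n → V (n + 1)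
      ≤ V n - (1 - R ^ 2) * (x (j + n) - z * x (j + n + 1)) ^ 2 := by
    intro n hn
    have h1 : ((1 - p (j + n + 1)) / p (j + n + 1)) ^ 2 ≤ R ^ 2 :=
      pow_le_pow_left₀ (hr0 _).le (hrR _ (by omega)) 2
    have h2 := sq_nonneg (x (j + n) - z * x (j + n + 1))
    rw [hVs]
    simp only [hV]
    nlinarith
  have hV1 : ∀ n, n0 ≤ n → V (n + 1) ≤ V n := fun n hn =>
    (hVd n hn).trans (sub_le_self _ (mul_nonneg hRsq.1.le (sq_nonneg _)))
  have hV2 : ∀ n, n0 ≤ n → V (n + 2) ≤ μ ^ 2 * V n := by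
    intro n hn
    have h1 := hVd n hn
    have h2 := hVd (n + 1) (by omega)
    have h3 := hstep (j + n) (by omega)
    have hr1 : ((1 - p (j + n + 1)) / p (j + n + 1)) ^ 2 ≤ 1 :=
      pow_le_one₀ (hr0 _).le ((hrR (j + n + 1) (by omega)).trans hR1.le)
    simp only [← add_assoc] at h2
    rw [hμ2, hθ]
    exact energy_two_step hz2 hρsq.1.le hRsq.1.le hr1 h3 h1 h2
  have hmain := le_geometric_of_two_step hV0 (by rw [hB]; linarith [sq_nonneg (1 / m)]) hμ0 hμ1.le
    hVB hV1 hV2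
  set A : ℝ := |x j| + |x (j + 1)| with hA
  have hA0 : 0 ≤ A := by positivity
  have hVA : V 0 ≤ A ^ 2 := by
    have h1 : V 0 = x j ^ 2 + x (j + 1) ^ 2 - 2 * (z * (x j * x (j + 1))) := by
      simp only [hV, add_zero]; ring
    have h2 : |z * (x j * x (j + 1))| ≤ |x j| * |x (j + 1)| := by
      rw [abs_mul, abs_mul]
      have : |z| ≤ 1 := hz.trans hρ1.le
      exact mul_le_of_le_one_left (by positivity) this
    have h3 := neg_abs_le (z * (x j * x (j + 1)))
    rw [h1, hA, add_sq, sq_abs, sq_abs]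
    linarith
  refine abs_le_geometric_of_energy (x := fun n => x (j + n)) hμ0 hρsq.1 (by positivity)
    (by positivity) hmain hVA hA0 (le_add_of_nonneg_right (abs_nonneg _)) fun n => ?_
  have h1 : (1 - ρ ^ 2) * x (j + n + 1) ^ 2 ≤ (1 - z ^ 2) * x (j + n + 1) ^ 2 :=
    mul_le_mul_of_nonneg_right (by linarith) (sq_nonneg _)
  exact h1.trans (le_add_of_nonneg_left (sq_nonneg _))

end Recursion

section Quadrature

variable {p : ℕ → ℝ}

lemma continuous_walkSolve (y : ℕ → ℝ) (a : ℝ) (i : ℕ) :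
    Continuous fun z => walkSolve p z y a i := by
  induction i using Nat.twoStepInduction with
  | zero => simp only [walkSolve]; fun_prop
  | one => simp only [walkSolve]; fun_prop
  | more i h1 h2 => simp only [walkSolve]; fun_prop

lemma walkSolve_one (hp : ∀ n, 0 < p n) (i : ℕ) : walkSolve p 1 0 1 i = 1 := by
  induction i using Nat.twoStepInduction with
  | zero => simp [walkSolve]
  | one => have := (hp 0).ne'; simp [walkSolve, this]
  | more i h1 h2 =>
    have := (hp (i + 1)).ne'
    simp only [walkSolve, h1, h2, Pi.zero_apply]
    field_simp
    ring

/-- There is a positive `ρ`-harmonic function with `ρ < 1`. -/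
lemma exists_positive_harmonic (hp : ∀ n, 0 < p n ∧ p n < 1) {n0 : ℕ} {α : ℝ} (hα : 0 < α)
    (hge : ∀ n, n0 ≤ n → 1 / 2 + α ≤ p n) :
    ∃ ρ : ℝ, 0 ≤ ρ ∧ ρ < 1 ∧ ∃ h : ℕ → ℝ, (∀ i, 0 < h i) ∧
      ∀ i, (1 - p i) * h (i - 1) + p i * h (i + 1) = ρ * h i := by
  have hα2 : α < 1 / 2 := by linarith [hge n0 le_rfl, (hp n0).2]
  set ρ₀ : ℝ := (1 / 2 - α) / (1 - α) + (1 / 2 + α) * (1 - α) with hρ₀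
  have hρ₀1 : ρ₀ < 1 := by
    rw [hρ₀, div_add' _ _ _ (by linarith : (1 - α) ≠ 0), div_lt_one (by linarith)]
    nlinarith [mul_pos hα hα]
  have hlim : ∀ i, Tendsto (fun z => walkSolve p z 0 1 i) (nhdsWithin 1 (Set.Iio 1)) (nhds 1) := by
    intro i
    have := (continuous_walkSolve (p := p) 0 1 i).tendsto 1
    rw [walkSolve_one fun n => (hp n).1] at this
    exact this.mono_left nhdsWithin_le_nhds
  have hev : ∀ᶠ z in nhdsWithin (1 : ℝ) (Set.Iio 1), ∀ i ∈ Finset.range (n0 + 1),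
      0 < walkSolve p z 0 1 i ∧
        (1 - α) * walkSolve p z 0 1 i < walkSolve p z 0 1 (i + 1) := by
    rw [Filter.eventually_all_finset]
    intro i _
    refine ((hlim i).eventually (lt_mem_nhds one_pos)).and ?_
    exact ((hlim i).const_mul (1 - α)).eventually_lt (hlim (i + 1)) (by linarith)
  have hev2 : ∀ᶠ z in nhdsWithin (1 : ℝ) (Set.Iio 1), max 0 ρ₀ < z :=
    nhdsWithin_le_nhds (lt_mem_nhds (max_lt one_pos hρ₀1))
  obtain ⟨ρ, ⟨hρ, hρm⟩, hρ1⟩ := ((hev.and hev2).and self_mem_nhdsWithin).exists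
  have hspec := walkSolve_spec (fun n => (hp n).1) ρ 0 1
  simp only [Pi.zero_apply, add_zero] at hspec
  refine ⟨ρ, (le_max_left _ _).trans hρm.le, hρ1, walkSolve p ρ 0 1, ?_, hspec⟩
  have key : ∀ i, 0 < walkSolve p ρ 0 1 i ∧
      (1 - α) * walkSolve p ρ 0 1 i ≤ walkSolve p ρ 0 1 (i + 1) := by
    intro i
    induction i with
    | zero => exact ⟨(hρ 0 (by simp)).1, (hρ 0 (by simp)).2.le⟩
    | succ i ih =>
      rcases Nat.lt_or_ge i n0 with hi | hi
      · have := hρ (i + 1) (by simpa using hi)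
        exact ⟨this.1, this.2.le⟩
      · have hpos : 0 < walkSolve p ρ 0 1 (i + 1) :=
          (mul_pos (by linarith) ih.1).trans_le ih.2
        refine ⟨hpos, ?_⟩
        have hs := hspec (i + 1)
        rw [Nat.add_sub_cancel] at hs
        have hpi := hge (i + 1) (by omega)
        have hpi1 := (hp (i + 1)).2
        have hτ : ((1 - p (i + 1)) + p (i + 1) * (1 - α) ^ 2) ≤ ρ * (1 - α) := by
          have h1 : ρ₀ * (1 - α) ≤ ρ * (1 - α) :=
            mul_le_mul_of_nonneg_right ((le_max_right _ _).trans hρm.le) (by linarith)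
          have h2 : ρ₀ * (1 - α) = (1 / 2 - α) + (1 / 2 + α) * (1 - α) ^ 2 := by
            have : (1 - α) ≠ 0 := by linarith
            rw [hρ₀]; field_simp
          have h3 : (1 - α) ^ 2 ≤ 1 := pow_le_one₀ (by linarith) (by linarith)
          have h4 := mul_nonneg (sub_nonneg.2 hpi) (sub_nonneg.2 h3)
          linarith
        have h1 : (1 - p (i + 1)) * ((1 - α) * walkSolve p ρ 0 1 i)
            ≤ (1 - p (i + 1)) * walkSolve p ρ 0 1 (i + 1) :=
          mul_le_mul_of_nonneg_left ih.2 (by linarith)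
        have h2 := mul_le_mul_of_nonneg_right hτ hpos.le
        have hfin : (p (i + 1) * (1 - α)) * ((1 - α) * walkSolve p ρ 0 1 (i + 1))
            ≤ (p (i + 1) * (1 - α)) * walkSolve p ρ 0 1 (i + 1 + 1) := by
          have h3 : (p (i + 1) * (1 - α)) * walkSolve p ρ 0 1 (i + 1 + 1)
              = (1 - α) * (ρ * walkSolve p ρ 0 1 (i + 1)
                - (1 - p (i + 1)) * walkSolve p ρ 0 1 i) := by
            rw [← hs]; ring
          rw [h3]
          linarith
        exact le_of_mul_le_mul_left hfin (mul_pos (hp (i + 1)).1 (by linarith))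
  exact fun i => (key i).1

/-- The eigenvalues of the walk killed at `N` are bounded by `ρ`. -/
lemma abs_eigenvalue_le (hp : ∀ n, 0 < p n ∧ p n < 1) {ρ : ℝ} {h : ℕ → ℝ} (hh : ∀ i, 0 < h i)
    (hharm : ∀ i, (1 - p i) * h (i - 1) + p i * h (i + 1) = ρ * h i) {N : ℕ} {z : ℝ} {v : ℕ → ℝ}
    (hv : ∀ i, N ≤ i → v i = 0) (hv0 : ∃ i, v i ≠ 0)
    (heig : ∀ i, i < N → (1 - p i) * v (i - 1) + p i * v (i + 1) = z * v i) : |z| ≤ ρ := by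
  obtain ⟨i₁, hi₁⟩ := hv0
  have hi₁N : i₁ < N := by
    by_contra hcon
    exact hi₁ (hv _ (by omega))
  obtain ⟨i, hi, hmax⟩ := (Finset.range N).exists_max_image (fun i => |v i| / h i)
    ⟨i₁, Finset.mem_range.2 hi₁N⟩
  have hle : ∀ k, |v k| ≤ |v i| / h i * h k := by
    intro k
    rcases Nat.lt_or_ge k N with hk | hk
    · exact (div_le_iff₀ (hh k)).1 (hmax k (Finset.mem_range.2 hk))
    · rw [hv k hk, abs_zero]
      exact mul_nonneg (div_nonneg (abs_nonneg _) (hh i).le) (hh k).le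
  have hvi : 0 < |v i| := by
    have h1 := hle i₁
    have h2 : 0 < |v i₁| := abs_pos.2 hi₁
    by_contra hcon
    have h3 : |v i| = 0 := le_antisymm (not_lt.1 hcon) (abs_nonneg _)
    rw [h3] at h1
    simp only [zero_div, zero_mul] at h1
    linarith
  have h1 := heig i (Finset.mem_range.1 hi)
  have h2 : |z| * |v i| ≤ (1 - p i) * |v (i - 1)| + p i * |v (i + 1)| := by
    rw [← abs_mul, ← h1]
    refine (abs_add_le _ _).trans_eq ?_
    rw [abs_mul, abs_mul, abs_of_pos (hp i).1, abs_of_pos (by linarith [(hp i).2] : 0 < 1 - p i)]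
  have h3 : (1 - p i) * |v (i - 1)| + p i * |v (i + 1)| ≤ ρ * |v i| := by
    calc _ ≤ (1 - p i) * (|v i| / h i * h (i - 1)) + p i * (|v i| / h i * h (i + 1)) :=
          add_le_add (mul_le_mul_of_nonneg_left (hle _) (by linarith [(hp i).2]))
            (mul_le_mul_of_nonneg_left (hle _) (hp i).1.le)
      _ = |v i| / h i * ((1 - p i) * h (i - 1) + p i * h (i + 1)) := by ring
      _ = ρ * |v i| := by
          rw [hharm]
          have := (hh i).ne'
          field_simp
  exact le_of_mul_le_mul_right (h2.trans h3) hvi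

lemma eq_mul_walkSolve (hp : ∀ n, 0 < p n) {N : ℕ} {z : ℝ} {v : ℕ → ℝ}
    (heig : ∀ i, i < N → (1 - p i) * v (i - 1) + p i * v (i + 1) = z * v i) :
    ∀ i, i ≤ N → v i = v 0 * walkSolve p z 0 1 i := by
  intro i
  induction i using Nat.twoStepInduction with
  | zero => simp [walkSolve]
  | one =>
    intro hi
    have h1 := heig 0 (by omega)
    have h2 := (hp 0).ne'
    simp only [Nat.zero_sub, zero_add] at h1
    simp only [walkSolve, Pi.zero_apply]
    field_simp
    linarith
  | more i ih1 ih2 =>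
    intro hi
    have h1 := heig (i + 1) (by omega)
    have h2 := (hp (i + 1)).ne'
    rw [Nat.add_sub_cancel, ih1 (by omega), ih2 (by omega)] at h1
    simp only [walkSolve, Pi.zero_apply]
    field_simp
    linarith

/-- The off-diagonal entries of the symmetrized walk. -/
noncomputable def jacobiWeight (p : ℕ → ℝ) (i : ℕ) : ℝ := √(p i * (1 - p (i + 1)))

/-- The symmetrized matrix of the walk killed at `N`. -/
noncomputable def jacobiMatrix (p : ℕ → ℝ) (N : ℕ) : Matrix (Fin N) (Fin N) ℝ :=
  Matrix.of fun i j => if (i : ℕ) = j then (if (i : ℕ) = 0 then 1 - p 0 else 0)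
    else if (j : ℕ) = i + 1 then jacobiWeight p i
    else if (i : ℕ) = j + 1 then jacobiWeight p j else 0

/-- The square root of the reversible measure of the walk. -/
noncomputable def sqrtMeasure (p : ℕ → ℝ) : ℕ → ℝ
  | 0 => 1
  | i + 1 => sqrtMeasure p i * √(p i / (1 - p (i + 1)))

lemma sqrtMeasure_pos (hp : ∀ n, 0 < p n ∧ p n < 1) (i : ℕ) : 0 < sqrtMeasure p i := by
  induction i with
  | zero => simp [sqrtMeasure]
  | succ i ih =>
    exact mul_pos ih (Real.sqrt_pos.2 (div_pos (hp i).1 (by linarith [(hp (i + 1)).2])))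

lemma jacobiWeight_mul_sqrtMeasure_succ (hp : ∀ n, 0 < p n ∧ p n < 1) (i : ℕ) :
    jacobiWeight p i * sqrtMeasure p (i + 1) = p i * sqrtMeasure p i := by
  have h1 : 0 < 1 - p (i + 1) := by linarith [(hp (i + 1)).2]
  have h2 := (hp i).1
  have h3 : jacobiWeight p i * √(p i / (1 - p (i + 1))) = p i := by
    rw [jacobiWeight, ← Real.sqrt_mul (by positivity), Real.sqrt_eq_iff_mul_self_eq_of_pos h2]
    field_simp
  rw [sqrtMeasure, mul_left_comm, h3, mul_comm]

lemma jacobiWeight_mul_sqrtMeasure (hp : ∀ n, 0 < p n ∧ p n < 1) (i : ℕ) :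
    jacobiWeight p i * sqrtMeasure p i = (1 - p (i + 1)) * sqrtMeasure p (i + 1) := by
  have h1 : 0 < 1 - p (i + 1) := by linarith [(hp (i + 1)).2]
  have h2 := (hp i).1
  have h3 : (1 - p (i + 1)) * √(p i / (1 - p (i + 1))) = jacobiWeight p i := by
    rw [jacobiWeight, eq_comm, Real.sqrt_eq_iff_mul_self_eq_of_pos (by positivity)]
    rw [mul_mul_mul_comm, Real.mul_self_sqrt (by positivity)]
    field_simp
  rw [sqrtMeasure, mul_left_comm, h3, mul_comm]

lemma jacobiMatrix_isHermitian (p : ℕ → ℝ) (N : ℕ) : (jacobiMatrix p N).IsHermitian := by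
  ext i j
  simp only [jacobiMatrix, Matrix.conjTranspose_apply, Matrix.of_apply, star_trivial]
  split_ifs <;> first | rfl | omega

lemma sum_jacobiMatrix {N : ℕ} {b : ℕ → ℝ} (hb : ∀ i, N ≤ i → b i = 0) (i : Fin N) :
    ∑ j, jacobiMatrix p N i j * b j
      = (if (i : ℕ) = 0 then (1 - p 0) * b 0 else jacobiWeight p (i - 1) * b (i - 1))
        + jacobiWeight p i * b (i + 1) := by
  obtain ⟨i, hi⟩ := i
  simp only [jacobiMatrix, Matrix.of_apply]
  rw [Fin.sum_univ_eq_sum_range (fun j => (if i = j then (if i = 0 then 1 - p 0 else 0)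
    else if j = i + 1 then jacobiWeight p i
    else if i = j + 1 then jacobiWeight p j else 0) * b j) N]
  have hext : ∀ j, (if i = j then (if i = 0 then 1 - p 0 else 0)
      else if j = i + 1 then jacobiWeight p i
      else if i = j + 1 then jacobiWeight p j else 0) * b j
      = (if j = i - 1 then (if i = 0 then (1 - p 0) * b 0 else jacobiWeight p (i - 1) * b (i - 1))
          else 0) + (if j = i + 1 then jacobiWeight p i * b (i + 1) else 0) := by
    intro j
    rcases Nat.eq_zero_or_pos i with rfl | hi0
    · rcases j with _ | _ | j <;> simp
    · by_cases h1 : j = i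
      · subst h1
        simp [hi0.ne', show ¬ j = j - 1 by omega]
      · by_cases h2 : j = i + 1
        · subst h2
          simp [show ¬ i + 1 = i - 1 by omega]
        · by_cases h3 : i = j + 1
          · subst h3
            simp [h2]
          · simp [Ne.symm h1, h2, h3, show ¬ j = i - 1 by omega]
  simp only [hext]
  rw [Finset.sum_add_distrib, Finset.sum_ite_eq', Finset.sum_ite_eq', if_pos (by simp; omega)]
  congr 1
  split_ifs with h
  · rfl
  · rw [hb _ (by simpa using h), mul_zero]

/-- Gauss quadrature for the orthogonal polynomials of the walk. -/
lemma exists_quadrature (hp : ∀ n, 0 < p n ∧ p n < 1) {ρ : ℝ} {h : ℕ → ℝ} (hh : ∀ i, 0 < h i)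
    (hharm : ∀ i, (1 - p i) * h (i - 1) + p i * h (i + 1) = ρ * h i) (N : ℕ) :
    ∃ w z : Fin (N + 1) → ℝ, (∀ k, 0 ≤ w k) ∧ (∀ k, |z k| ≤ ρ) ∧
      ∀ i, i ≤ N → ∑ k, w k * walkSolve p (z k) 0 1 i = if i = 0 then 1 else 0 := by
  have hA := jacobiMatrix_isHermitian p (N + 1)
  set E := hA.eigenvectorBasis with hE
  set b : Fin (N + 1) → ℕ → ℝ := fun k i => if hi : i < N + 1 then E k ⟨i, hi⟩ else 0 with hb
  have hbE : ∀ k (i : Fin (N + 1)), b k i = E k i := fun k i => by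
    simp only [hb]
    rw [dif_pos i.2]
  have hb0 : ∀ k i, N + 1 ≤ i → b k i = 0 := fun k i hi => by
    simp only [hb]
    rw [dif_neg (by omega)]
  set v : Fin (N + 1) → ℕ → ℝ := fun k i => b k i / sqrtMeasure p i with hv
  have hbv : ∀ k i, b k i = sqrtMeasure p i * v k i := fun k i => by
    have := (sqrtMeasure_pos hp i).ne'
    simp only [hv]
    field_simp
  have heig : ∀ k i, i < N + 1 → (1 - p i) * v k (i - 1) + p i * v k (i + 1)
      = hA.eigenvalues k * v k i := by
    intro k i hi
    have h1 := congrFun (hA.mulVec_eigenvectorBasis k) ⟨i, hi⟩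
    have h2 := sum_jacobiMatrix (p := p) (hb0 k) ⟨i, hi⟩
    have h3 : ∑ j, jacobiMatrix p (N + 1) ⟨i, hi⟩ j * b k j = hA.eigenvalues k * b k i := by
      have h4 : b k i = E k ⟨i, hi⟩ := hbE k ⟨i, hi⟩
      simp only [hbE, h4]
      simpa [Matrix.mulVec, dotProduct] using h1
    rw [h3] at h2
    simp only [hbv] at h2
    have hs := sqrtMeasure_pos hp i
    have h5 := jacobiWeight_mul_sqrtMeasure_succ hp i
    rw [← mul_assoc (jacobiWeight p i), h5] at h2
    refine mul_left_cancel₀ hs.ne' ?_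
    rcases i with _ | i
    · simp only [if_pos, Nat.zero_sub] at h2 ⊢
      simp only [sqrtMeasure] at h2 ⊢
      linarith
    · have h6 := jacobiWeight_mul_sqrtMeasure hp i
      simp only [Nat.add_sub_cancel, if_neg (Nat.succ_ne_zero i)] at h2 ⊢
      rw [← mul_assoc (jacobiWeight p i), h6] at h2
      linarith
  have hv0 : ∀ k i, N + 1 ≤ i → v k i = 0 := fun k i hi => by simp [hv, hb0 k i hi]
  have hvne : ∀ k, ∃ i, v k i ≠ 0 := by
    intro k
    by_contra! hcon
    have : E k = 0 := by
      ext i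
      rw [← hbE, hbv, hcon, mul_zero]
      rfl
    have h1 := E.orthonormal.1 k
    rw [this, norm_zero] at h1
    exact zero_ne_one h1
  refine ⟨fun k => v k 0 ^ 2, hA.eigenvalues, fun k => sq_nonneg _,
    fun k => abs_eigenvalue_le hp hh hharm (hv0 k) (hvne k) (heig k), fun i hi => ?_⟩
  have h1 : ∀ k, v k 0 ^ 2 * walkSolve p (hA.eigenvalues k) 0 1 i = v k 0 * v k i := by
    intro k
    rw [eq_mul_walkSolve (fun n => (hp n).1) (heig k) i (by omega)]
    ring
  simp only [h1]
  have h2 := E.sum_repr (EuclideanSpace.single (0 : Fin (N + 1)) (1 : ℝ))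
  have h3 := congrArg (fun x : EuclideanSpace ℝ (Fin (N + 1)) => x ⟨i, by omega⟩) h2
  have hvE : ∀ k, v k 0 = E k 0 := fun k => by
    have := hbv k 0
    rw [sqrtMeasure, one_mul] at this
    rw [← this]
    exact hbE k 0
  have h4 : ∑ k, E k 0 * E k ⟨i, by omega⟩ = if i = 0 then 1 else 0 := by
    simp only [OrthonormalBasis.repr_apply_apply, EuclideanSpace.inner_single_right] at h3
    simp only [WithLp.ofLp_sum, Finset.sum_apply, PiLp.smul_apply, smul_eq_mul, one_mul,
      conj_trivial, Finset.sum_apply, PiLp.single_apply] at h3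
    simpa [Fin.ext_iff] using h3
  have h5 : ∀ k, v k i = E k ⟨i, by omega⟩ / sqrtMeasure p i := fun k => by
    simp only [hv, hb]
    rw [dif_pos (by omega)]
  simp only [hvE, h5, ← mul_div_assoc]
  rw [← Finset.sum_div, h4]
  split_ifs with h0
  · subst h0
    simp [sqrtMeasure]
  · simp

end Quadrature

section SequenceSpace

lemma walkSolve_single_of_le {p : ℕ → ℝ} (j : ℕ) (z : ℝ) (i : ℕ) (hij : i ≤ j) :
    walkSolve p z (Pi.single j 1) 0 i = 0 := by
  induction i using Nat.twoStepInduction with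
  | zero => simp [walkSolve]
  | one => simp [walkSolve, show ¬ 0 = j by omega]
  | more i h1 h2 =>
    have h3 := h1 (by omega)
    have h4 := h2 (by omega)
    simp [walkSolve, h3, h4, show ¬ i + 1 = j by omega]

/-- The data of a Banach sequence space with coordinate map `c` and canonical basis `e`, on which
weighted composition operators with bounded weights and injective symbols are bounded. -/
structure IsSequenceSpace {X : Type*} [NormedAddCommGroup X] [NormedSpace ℂ X]
    (c : X →ₗ[ℂ] (ℕ → ℂ)) (e : ℕ → X) : Prop where
  injective : Function.Injective c
  norm_coord_le : ∀ x i, ‖c x i‖ ≤ ‖x‖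
  coord_basis : ∀ j, c (e j) = Pi.single j 1
  norm_basis_le : ∀ j, ‖e j‖ ≤ 1
  dense_span : Dense (Submodule.span ℂ (Set.range e) : Set X)
  exists_weighted : ∀ (a : ℕ → ℂ) (σ : ℕ → ℕ) (B : ℝ), 0 ≤ B → (∀ i, ‖a i‖ ≤ B) →
    Set.InjOn σ {i | a i ≠ 0} → ∃ A : X →L[ℂ] X, ‖A‖ ≤ B ∧ ∀ x i, c (A x) i = a i * c x (σ i)

variable {X : Type*} [NormedAddCommGroup X] [NormedSpace ℂ X]

/-- A closed invariant subspace contains the solutions of `y = m + A y` when `‖A‖ < 1`. -/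
lemma mem_of_eq_add_apply {M : Submodule ℂ X} (hM : IsClosed (M : Set X)) {A : X →L[ℂ] X}
    (hA : ‖A‖ < 1) (hAM : ∀ m ∈ M, A m ∈ M) {m y : X} (hm : m ∈ M) (hy : y = m + A y) :
    y ∈ M := by
  have h1 : ∀ n : ℕ, y - (A ^ n) y ∈ M := by
    intro n
    induction n with
    | zero => simp
    | succ n ih =>
      have h2 : y - (A ^ (n + 1)) y = m + A (y - (A ^ n) y) := by
        rw [pow_succ', map_sub, mul_apply_eq_comp, ← add_sub_assoc, ← hy]
      rw [h2]
      exact M.add_mem hm (hAM _ ih)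
  have h2 : Tendsto (fun n : ℕ => y - (A ^ n) y) atTop (nhds (y - (0 : X →L[ℂ] X) y)) :=
    tendsto_const_nhds.sub
      (((ContinuousLinearMap.apply ℂ X y).continuous.tendsto 0).comp
        (tendsto_pow_atTop_nhds_zero_of_norm_lt_one hA))
  have h3 := hM.mem_of_tendsto h2 (Eventually.of_forall h1)
  simpa using h3

/-- Propagation of membership along a family satisfying resolvent identities. -/
lemma mem_of_resolvent_identity {M : Submodule ℂ X} (hM : IsClosed (M : Set X))
    {S : ℝ → X →L[ℂ] X} {P : ℝ → X} {ρ K : ℝ} (hS : ∀ z, |z| ≤ ρ → ‖S z‖ ≤ K)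
    (hSS : ∀ z w, |z| ≤ ρ → |w| ≤ ρ → ∀ x, S w x = S z x + ((w - z : ℝ) : ℂ) • S z (S w x))
    (hSP : ∀ z w, |z| ≤ ρ → |w| ≤ ρ → P w = P z + ((w - z : ℝ) : ℂ) • S z (P w))
    (h0S : ∀ m ∈ M, S 0 m ∈ M) (h0P : P 0 ∈ M) {z : ℝ} (hz : |z| ≤ ρ) : P z ∈ M := by
  have hρ : 0 ≤ ρ := (abs_nonneg z).trans hz
  have hK : 0 ≤ K := (norm_nonneg _).trans (hS z hz)
  set η : ℝ := 1 / (2 * (K + 1)) with hη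
  have hη0 : 0 < η := by positivity
  have hηK : η * K < 1 := by
    rw [hη, div_mul_eq_mul_div, div_lt_one (by positivity)]
    linarith
  have key : ∀ (n : ℕ) (z : ℝ), |z| ≤ ρ → |z| ≤ n * η → P z ∈ M ∧ ∀ m ∈ M, S z m ∈ M := by
    intro n
    induction n with
    | zero =>
      intro z _ hz
      have : z = 0 := abs_nonpos_iff.1 (by simpa using hz)
      subst this
      exact ⟨h0P, h0S⟩
    | succ n ih =>
      intro w hw hwn
      have hn : (0 : ℝ) < n + 1 := by positivity
      push_cast at hwn
      have hz1 : |w * (n / (n + 1))| = |w| * (n / (n + 1)) := by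
        rw [abs_mul, abs_of_nonneg (by positivity : (0 : ℝ) ≤ n / (n + 1))]
      have hz2 : |w * (n / (n + 1))| ≤ ρ := by
        rw [hz1]
        refine (mul_le_of_le_one_right (abs_nonneg w) ?_).trans hw
        rw [div_le_one hn]
        linarith
      have hz3 : |w * (n / (n + 1))| ≤ n * η := by
        rw [hz1, ← mul_div_assoc, div_le_iff₀ hn]
        calc |w| * n ≤ ((n + 1) * η) * n := mul_le_mul_of_nonneg_right hwn (by positivity)
          _ = _ := by ring
      have hd : |w - w * (n / (n + 1))| ≤ η := by
        have : w - w * (n / (n + 1)) = w / (n + 1) := by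
          field_simp
          ring
        rw [this, abs_div, abs_of_pos hn, div_le_iff₀ hn]
        linarith
      obtain ⟨hP, hSM⟩ := ih _ hz2 hz3
      set z := w * (n / (n + 1)) with hz
      have hA : ‖((w - z : ℝ) : ℂ) • S z‖ < 1 := by
        rw [norm_smul, Complex.norm_real, Real.norm_eq_abs]
        exact (mul_le_mul hd (hS z hz2) (norm_nonneg _) hη0.le).trans_lt hηK
      have hAM : ∀ m ∈ M, (((w - z : ℝ) : ℂ) • S z) m ∈ M := fun m hm =>
        M.smul_mem _ (hSM m hm)
      exact ⟨mem_of_eq_add_apply hM hA hAM hP (hSP z w hz2 hw), fun m hm =>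
        mem_of_eq_add_apply hM hA hAM (hSM m hm) (hSS z w hz2 hw m)⟩
  obtain ⟨n, hn⟩ := exists_nat_ge (|z| / η)
  exact (key n z hz ((div_le_iff₀ hη0).1 hn)).1

namespace IsSequenceSpace

variable {c : X →ₗ[ℂ] (ℕ → ℂ)} {e : ℕ → X}

/-- The coordinate functionals. -/
noncomputable def coord (hX : IsSequenceSpace c e) (i : ℕ) : X →L[ℂ] ℂ :=
  LinearMap.mkContinuous ((LinearMap.proj i).comp c) 1 fun x => by
    simpa using hX.norm_coord_le x i

lemma coord_apply (hX : IsSequenceSpace c e) (i : ℕ) (x : X) : hX.coord i x = c x i := rfl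

lemma norm_le_of_geometric [CompleteSpace X] (hX : IsSequenceSpace c e) {x : X} {D κ : ℝ}
    (hκ0 : 0 ≤ κ) (hκ1 : κ < 1) (hx : ∀ i, ‖c x i‖ ≤ D * κ ^ i) : ‖x‖ ≤ D * (1 - κ)⁻¹ := by
  have hb : ∀ i, ‖c x i • e i‖ ≤ D * κ ^ i := fun i => by
    rw [norm_smul]
    exact (mul_le_of_le_one_right (norm_nonneg _) (hX.norm_basis_le i)).trans (hx i)
  have hg := (hasSum_geometric_of_lt_one hκ0 hκ1).mul_left D
  have hs : Summable fun i => c x i • e i := Summable.of_norm_bounded hg.summable hb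
  have hsum : ∑' i, c x i • e i = x := by
    refine hX.injective (funext fun j => ?_)
    have h1 := hs.hasSum.mapL (hX.coord j)
    have h2 : HasSum (fun i => hX.coord j (c x i • e i)) (c x j) := by
      have h3 : (fun i => hX.coord j (c x i • e i)) = fun i => if i = j then c x j else 0 := by
        funext i
        rw [map_smul, hX.coord_apply, hX.coord_basis, smul_eq_mul, Pi.single_apply]
        by_cases h : i = j
        · simp [h]
        · simp [h, Ne.symm h]
      rw [h3]
      exact hasSum_ite_eq j (c x j)
    exact h1.unique h2
  rw [← hsum]
  exact tsum_of_norm_bounded hg hb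

lemma exists_walk (hX : IsSequenceSpace c e) {p : ℕ → ℝ} (hp : ∀ n, 0 < p n ∧ p n < 1) :
    ∃ G : X →L[ℂ] X, ∀ x i, c (G x) i
      = ((1 - p i : ℝ) : ℂ) * c x (i - 1) + ((p i : ℝ) : ℂ) * c x (i + 1) := by
  have hn : ∀ {t : ℝ}, 0 < t → t < 1 → ‖(t : ℂ)‖ ≤ 1 := fun {t} h0 h1 => by
    rw [Complex.norm_real, Real.norm_of_nonneg h0.le]
    exact h1.le
  have hn' : ∀ i, ‖((1 - p i : ℝ) : ℂ)‖ ≤ 1 := fun i =>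
    hn (by linarith [(hp i).2]) (by linarith [(hp i).1])
  obtain ⟨U, -, hU⟩ := hX.exists_weighted (fun i => ((p i : ℝ) : ℂ)) (fun i => i + 1) 1
    zero_le_one (fun i => hn (hp i).1 (hp i).2) fun i _ j _ h => by simpa using h
  obtain ⟨D, -, hD⟩ := hX.exists_weighted (fun i => if i = 0 then 0 else ((1 - p i : ℝ) : ℂ))
    (fun i => i - 1) 1 zero_le_one
    (fun i => by
      split_ifs with h
      · simp
      · exact hn' i)
    fun i hi j hj h => by
      have h1 : i ≠ 0 := fun h => hi (if_pos h)
      have h2 : j ≠ 0 := fun h => hj (if_pos h)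
      simp only at h
      omega
  obtain ⟨L, -, hL⟩ := hX.exists_weighted (fun i => if i = 0 then ((1 - p i : ℝ) : ℂ) else 0)
    (fun i => i) 1 zero_le_one
    (fun i => by
      split_ifs with h
      · exact hn' i
      · simp)
    fun i _ j _ h => h
  refine ⟨U + D + L, fun x i => ?_⟩
  simp only [add_apply, map_add, Pi.add_apply, hU, hD, hL]
  rcases i with _ | i
  · simp
    ring
  · simp
    ring

section Walk

variable {p : ℕ → ℝ} {G : X →L[ℂ] X}

lemma eq_zero_of_walk_eq_smul
    (hG : ∀ x i, c (G x) i = ((1 - p i : ℝ) : ℂ) * c x (i - 1) + ((p i : ℝ) : ℂ) * c x (i + 1))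
    (hX : IsSequenceSpace c e) (hp : ∀ n, 0 < p n) {z : ℂ} {x : X}
    (hx : G x = z • x) (hx0 : c x 0 = 0) : x = 0 := by
  refine hX.injective (funext fun i => ?_)
  have hstep : ∀ i, ((1 - p i : ℝ) : ℂ) * c x (i - 1) + ((p i : ℝ) : ℂ) * c x (i + 1)
      = z * c x i := fun i => by
    rw [← hG, hx, map_smul]
    rfl
  have hne : ∀ i, ((p i : ℝ) : ℂ) ≠ 0 := fun i => Complex.ofReal_ne_zero.2 (hp i).ne'
  rw [map_zero]
  induction i using Nat.twoStepInduction with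
  | zero => exact hx0
  | one =>
    have := hstep 0
    simpa [hx0, hne] using this
  | more i h1 h2 =>
    have := hstep (i + 1)
    rw [Nat.add_sub_cancel, h1, h2] at this
    simpa [hne] using this

lemma exists_right_inverse [CompleteSpace X]
    (hG : ∀ x i, c (G x) i = ((1 - p i : ℝ) : ℂ) * c x (i - 1) + ((p i : ℝ) : ℂ) * c x (i + 1))
    (hX : IsSequenceSpace c e) (hp : ∀ n, 0 < p n)
    {z K κ : ℝ} (hK : 0 ≤ K) (hκ0 : 0 ≤ κ) (hκ1 : κ < 1)
    (hdecay : ∀ j n, |walkSolve p z (Pi.single j 1) 0 (j + n)| ≤ K * κ ^ n) :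
    ∃ S : X →L[ℂ] X, ‖S‖ ≤ K * (1 - κ)⁻¹ ∧ (∀ x, c (S x) 0 = 0) ∧
      ∀ x, G (S x) = (z : ℂ) • S x + x := by
  set φ : ℕ → ℕ → ℝ := fun j => walkSolve p z (Pi.single j 1) 0 with hφ
  have hφ0 : ∀ j i, i ≤ j → φ j i = 0 := fun j => walkSolve_single_of_le j z
  have hA : ∀ k : ℕ, ∃ A : X →L[ℂ] X, ‖A‖ ≤ K * κ ^ k ∧
      ∀ x i, c (A x) i = (if k ≤ i then ((φ (i - k) i : ℝ) : ℂ) else 0) * c x (i - k) := by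
    intro k
    refine hX.exists_weighted (fun i => if k ≤ i then ((φ (i - k) i : ℝ) : ℂ) else 0)
      (fun i => i - k) _ (by positivity) (fun i => ?_) fun i hi j hj h => ?_
    · split_ifs with h
      · rw [Complex.norm_real, Real.norm_eq_abs]
        have := hdecay (i - k) k
        rwa [Nat.sub_add_cancel h] at this
      · rw [norm_zero]
        positivity
    · have h1 : k ≤ i := by
        by_contra hcon
        exact hi (if_neg hcon)
      have h2 : k ≤ j := by
        by_contra hcon
        exact hj (if_neg hcon)
      simp only at h
      omega
  choose A hAn hAc using hA
  have hg := (hasSum_geometric_of_lt_one hκ0 hκ1).mul_left K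
  have hs : Summable A := Summable.of_norm_bounded hg.summable hAn
  have hcoord : ∀ x i, HasSum (fun k => (if k ≤ i then ((φ (i - k) i : ℝ) : ℂ) else 0)
      * c x (i - k)) (c ((∑' k, A k) x) i) := by
    intro x i
    have h1 := (hs.hasSum.mapL (ContinuousLinearMap.apply ℂ X x)).mapL (hX.coord i)
    simp only [ContinuousLinearMap.apply_apply, hX.coord_apply, hAc] at h1
    exact h1
  have h0 : ∀ x, c ((∑' k, A k) x) 0 = 0 := by
    intro x
    refine (hcoord x 0).unique ?_
    convert hasSum_zero with k
    simp [hφ0]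
  have hbasis : ∀ j i, c ((∑' k, A k) (e j)) i = ((φ j i : ℝ) : ℂ) := by
    intro j i
    refine (hcoord (e j) i).unique ?_
    have h1 : (fun k => (if k ≤ i then ((φ (i - k) i : ℝ) : ℂ) else 0) * c (e j) (i - k))
        = fun k => if k = i - j then ((φ j i : ℝ) : ℂ) else 0 := by
      funext k
      rw [hX.coord_basis, Pi.single_apply]
      rcases Nat.lt_or_ge i j with hij | hij
      · rw [hφ0 j i hij.le, if_neg (show ¬ i - k = j by omega)]
        simp
      · by_cases hk : k = i - j
        · subst hk
          simp [show i - (i - j) = j by omega]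
        · by_cases hki : k ≤ i
          · simp [hk, show ¬ i - k = j by omega]
          · simp [hk, hki]
    rw [h1]
    exact hasSum_ite_eq _ _
  refine ⟨∑' k, A k, tsum_of_norm_bounded hg hAn, h0, ?_⟩
  have hext : G.comp (∑' k, A k) = (z : ℂ) • (∑' k, A k) + ContinuousLinearMap.id ℂ X := by
    refine ContinuousLinearMap.ext_on hX.dense_span ?_
    rintro _ ⟨j, rfl⟩
    refine hX.injective (funext fun i => ?_)
    have h1 := walkSolve_spec hp z (Pi.single j 1) 0 i
    have h2 : (((Pi.single j 1 : ℕ → ℝ) i : ℝ) : ℂ) = (Pi.single j 1 : ℕ → ℂ) i := by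
      simp only [Pi.single_apply]
      split_ifs <;> simp
    simp only [ContinuousLinearMap.comp_apply, add_apply,
      smul_apply, ContinuousLinearMap.id_apply, map_add, map_smul,
      Pi.add_apply, Pi.smul_apply, hG, hbasis, smul_eq_mul, hX.coord_basis]
    rw [← h2]
    exact_mod_cast h1
  intro x
  have := congrArg (fun T : X →L[ℂ] X => T x) hext
  simpa using this

/-- The walk is surjective, and its kernel together with a suitable right inverse generates
the whole space. -/
lemma exists_generator [CompleteSpace X]
    (hG : ∀ x i, c (G x) i = ((1 - p i : ℝ) : ℂ) * c x (i - 1) + ((p i : ℝ) : ℂ) * c x (i + 1))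
    (hX : IsSequenceSpace c e)
    (hp : ∀ n, 0 < p n ∧ p n < 1) {n0 : ℕ} {α : ℝ} (hα : 0 < α)
    (hge : ∀ n, n0 ≤ n → 1 / 2 + α ≤ p n) :
    ∃ (S : X →L[ℂ] X) (u : X), (∀ x, G (S x) = x) ∧ G u = 0 ∧ c u 0 = 1 ∧
      ∀ M : Submodule ℂ X, IsClosed (M : Set X) → u ∈ M → (∀ m ∈ M, S m ∈ M) →
        (∀ m ∈ M, G m ∈ M) → M = ⊤ := by
  have hp0 : ∀ n, 0 < p n := fun n => (hp n).1
  obtain ⟨ρ, hρ0, hρ1, h, hh, hharm⟩ := exists_positive_harmonic hp hα hge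
  obtain ⟨C, κ, hC, hκ0, hκ1, hdecay⟩ := exists_decay hp hα hge hρ0 hρ1
  obtain ⟨m, hm0, hm⟩ := exists_lower_bound hp0 (by linarith : 0 < 1 / 2 + α) hge
  have hsolver : ∀ z, |z| ≤ ρ → ∃ S : X →L[ℂ] X, ‖S‖ ≤ C * (1 / m) * (1 - κ)⁻¹ ∧
      (∀ x, c (S x) 0 = 0) ∧ ∀ x, G (S x) = (z : ℂ) • S x + x := by
    intro z hz
    refine exists_right_inverse hG hX hp0 (by positivity) hκ0.le hκ1 fun j n => ?_
    have h0 : ∀ i, i ≤ j → walkSolve p z (Pi.single j 1) 0 i = 0 := walkSolve_single_of_le j z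
    have h1 : walkSolve p z (Pi.single j 1) 0 (j + 1) = 1 / p j := by
      have h2 := walkSolve_spec hp0 z (Pi.single j 1) 0 j
      rw [h0 j le_rfl, h0 (j - 1) (by omega), Pi.single_eq_same, mul_zero, mul_zero, zero_add,
        zero_add] at h2
      rw [eq_div_iff (hp0 j).ne', mul_comm, h2]
    have h2 := hdecay z hz (walkSolve p z (Pi.single j 1) 0) j (fun i hi => by
      have h3 := walkSolve_spec hp0 z (Pi.single j 1) 0 (i + 1)
      rwa [Nat.add_sub_cancel, Pi.single_eq_of_ne (by omega), add_zero] at h3) n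
    rw [h0 j le_rfl, h1, abs_zero, zero_add, abs_of_pos (one_div_pos.2 (hp0 j))] at h2
    refine h2.trans ?_
    rw [mul_right_comm]
    exact mul_le_mul_of_nonneg_right
      (mul_le_mul_of_nonneg_left (one_div_le_one_div_of_le hm0 (hm j)) hC.le) (by positivity)
  choose! S hSn hS0 hSG using hsolver
  set P : ℝ → X := fun z => e 0 - S z (G (e 0) - (z : ℂ) • e 0) with hP
  have hPG : ∀ z, |z| ≤ ρ → G (P z) = (z : ℂ) • P z := by
    intro z hz
    simp only [hP, map_sub, hSG z hz, smul_sub]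
    abel
  have hP0 : ∀ z, |z| ≤ ρ → c (P z) 0 = 1 := by
    intro z hz
    simp only [hP]
    rw [map_sub, Pi.sub_apply, hS0 z hz, hX.coord_basis]
    simp
  have hPc : ∀ z, |z| ≤ ρ → ∀ i, c (P z) i = ((walkSolve p z 0 1 i : ℝ) : ℂ) := by
    intro z hz i
    have hstep : ∀ i, ((1 - p i : ℝ) : ℂ) * c (P z) (i - 1) + ((p i : ℝ) : ℂ) * c (P z) (i + 1)
        = z * c (P z) i := fun i => by
      rw [← hG, hPG z hz, map_smul]
      rfl
    have hstep' : ∀ i, ((1 - p i : ℝ) : ℂ) * (walkSolve p z 0 1 (i - 1) : ℝ)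
        + ((p i : ℝ) : ℂ) * (walkSolve p z 0 1 (i + 1) : ℝ) = z * (walkSolve p z 0 1 i : ℝ) :=
      fun i => by
        have h1 := walkSolve_spec hp0 z 0 1 i
        rw [Pi.zero_apply, add_zero] at h1
        exact_mod_cast h1
    have hne : ∀ i, ((p i : ℝ) : ℂ) ≠ 0 := fun i => Complex.ofReal_ne_zero.2 (hp0 i).ne'
    have hzero : c (P z) 0 = ((walkSolve p z 0 1 0 : ℝ) : ℂ) := by
      rw [hP0 z hz]
      simp [walkSolve]
    induction i using Nat.twoStepInduction with
    | zero => exact hzero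
    | one =>
      have h1 := (hstep 0).trans (by rw [hzero] : _ = _) |>.trans (hstep' 0).symm
      simp only [Nat.zero_sub, hzero] at h1
      exact mul_left_cancel₀ (hne 0) (add_left_cancel h1)
    | more i h1 h2 =>
      have h3 := (hstep (i + 1)).trans (by rw [h2] : _ = _) |>.trans (hstep' (i + 1)).symm
      simp only [Nat.add_sub_cancel, h1] at h3
      exact mul_left_cancel₀ (hne (i + 1)) (add_left_cancel h3)
  have hSS : ∀ z w, |z| ≤ ρ → |w| ≤ ρ → ∀ x,
      S w x = S z x + ((w - z : ℝ) : ℂ) • S z (S w x) := by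
    intro z w hz hw x
    have h1 := eq_zero_of_walk_eq_smul hG hX hp0 (z := z)
      (x := S w x - S z x - ((w - z : ℝ) : ℂ) • S z (S w x)) (by
        simp only [map_sub, map_smul, hSG z hz, hSG w hw]
        push_cast
        module) (by simp [hS0 z hz, hS0 w hw])
    rw [sub_sub, sub_eq_zero] at h1
    exact h1
  have hSP : ∀ z w, |z| ≤ ρ → |w| ≤ ρ → P w = P z + ((w - z : ℝ) : ℂ) • S z (P w) := by
    intro z w hz hw
    have h1 := eq_zero_of_walk_eq_smul hG hX hp0 (z := z)
      (x := P w - P z - ((w - z : ℝ) : ℂ) • S z (P w)) (by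
        simp only [map_sub, map_smul, hSG z hz, hPG z hz, hPG w hw]
        push_cast
        module) (by simp [hS0 z hz, hP0 z hz, hP0 w hw])
    rw [sub_sub, sub_eq_zero] at h1
    exact h1
  have h00 : |(0 : ℝ)| ≤ ρ := by simpa using hρ0
  refine ⟨S 0, P 0, fun x => by simpa using hSG 0 h00 x, by simpa using hPG 0 h00, hP0 0 h00,
    fun M hM hu hSM hGM => ?_⟩
  have hPM : ∀ z, |z| ≤ ρ → P z ∈ M := fun z hz =>
    mem_of_resolvent_identity hM hSn hSS hSP hSM hu hz
  have hbound : ∀ z, |z| ≤ ρ → ∀ i, |walkSolve p z 0 1 i| ≤ C * (1 + 2 / p 0) * κ ^ i := by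
    intro z hz i
    have h1 := hdecay z hz (walkSolve p z 0 1) 0 (fun i _ => by
      have h3 := walkSolve_spec hp0 z 0 1 (i + 1)
      rwa [Nat.add_sub_cancel, Pi.zero_apply, add_zero] at h3) i
    have h2 : |walkSolve p z 0 1 (0 + 1)| ≤ 2 / p 0 := by
      simp only [zero_add, walkSolve, Pi.zero_apply, mul_one]
      rw [abs_div, abs_of_pos (hp0 0)]
      refine div_le_div_of_nonneg_right ?_ (hp0 0).le
      have := abs_le.1 (hz.trans hρ1.le)
      rw [abs_le]
      constructor <;> linarith [(hp 0).1, (hp 0).2]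
    have h3 : |walkSolve p z 0 1 0| = 1 := by simp [walkSolve]
    rw [h3, zero_add] at h1
    refine h1.trans ?_
    rw [mul_right_comm]
    exact mul_le_mul_of_nonneg_right (mul_le_mul_of_nonneg_left (by simpa using h2) hC.le)
      (by positivity)
  set s := √κ with hs
  have hs0 : 0 ≤ s := Real.sqrt_nonneg _
  have hs1 : s < 1 := by rw [hs, Real.sqrt_lt' one_pos]; linarith
  have hs2 : κ = s * s := (Real.mul_self_sqrt hκ0.le).symm
  set K := C * (1 + 2 / p 0) with hK
  have hK0 : 0 ≤ K := mul_nonneg hC.le (by have := hp0 0; positivity)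
  have happrox : ∀ N : ℕ, ∃ y ∈ M, ‖y - e 0‖ ≤ K * s ^ N * (1 - s)⁻¹ := by
    intro N
    obtain ⟨w, z, hw, hz, hq⟩ := exists_quadrature hp hh hharm N
    have hw1 : ∑ k, w k = 1 := by
      have := hq 0 (Nat.zero_le N)
      simpa [walkSolve] using this
    refine ⟨∑ k, (w k : ℂ) • P (z k), M.sum_mem fun k _ => M.smul_mem _ (hPM _ (hz k)),
      hX.norm_le_of_geometric hs0 hs1 fun i => ?_⟩
    have hc : c (∑ k, (w k : ℂ) • P (z k) - e 0) i
        = ((∑ k, w k * walkSolve p (z k) 0 1 i - (if i = 0 then 1 else 0) : ℝ) : ℂ) := by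
      simp only [map_sub, map_sum, map_smul, Pi.sub_apply, Finset.sum_apply, Pi.smul_apply,
        smul_eq_mul, hPc _ (hz _), hX.coord_basis, Pi.single_apply]
      push_cast
      congr 1
      split_ifs <;> simp
    rw [hc, Complex.norm_real, Real.norm_eq_abs]
    rcases Nat.lt_or_ge N i with hi | hi
    · rw [if_neg (by omega), sub_zero]
      calc |∑ k, w k * walkSolve p (z k) 0 1 i|
          ≤ ∑ k, |w k * walkSolve p (z k) 0 1 i| := Finset.abs_sum_le_sum_abs _ _
        _ ≤ ∑ k, w k * (K * κ ^ i) := Finset.sum_le_sum fun k _ => by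
            rw [abs_mul, abs_of_nonneg (hw k)]
            exact mul_le_mul_of_nonneg_left (hbound _ (hz k) i) (hw k)
        _ = K * (s ^ i * s ^ i) := by rw [← Finset.sum_mul, hw1, one_mul, hs2, mul_pow]
        _ ≤ K * (s ^ N * s ^ i) := by
            have := pow_le_pow_of_le_one hs0 hs1.le hi.le
            gcongr
        _ = _ := by ring
    · rw [hq i hi, sub_self, abs_zero]
      positivity
  have he0 : e 0 ∈ M := by
    choose y hyM hy using happrox
    refine hM.mem_of_tendsto (f := y) (b := atTop) ?_ (Eventually.of_forall hyM)
    rw [tendsto_iff_norm_sub_tendsto_zero]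
    refine squeeze_zero (fun _ => norm_nonneg _) hy ?_
    have := ((tendsto_pow_atTop_nhds_zero_of_lt_one hs0 hs1).const_mul K).mul_const (1 - s)⁻¹
    simpa using this
  have hGe : ∀ j, G (e (j + 1)) = ((p j : ℝ) : ℂ) • e j
      + ((1 - p (j + 2) : ℝ) : ℂ) • e (j + 2) := by
    intro j
    refine hX.injective (funext fun i => ?_)
    simp only [hG, map_add, map_smul, Pi.add_apply, Pi.smul_apply, smul_eq_mul, hX.coord_basis,
      Pi.single_apply]
    rcases lt_trichotomy i (j + 1) with hi | hi | hi
    · by_cases hij : i = j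
      · subst hij
        simp [show ¬ i - 1 = i + 1 by omega]
      · simp [hij, show ¬ i - 1 = j + 1 by omega, show ¬ i = j + 2 by omega]
    · subst hi
      simp
    · by_cases hij : i = j + 2
      · subst hij
        simp
      · simp [hij, show ¬ i - 1 = j + 1 by omega, show ¬ i = j by omega]
  have hGe0 : G (e 0) = ((1 - p 0 : ℝ) : ℂ) • e 0 + ((1 - p 1 : ℝ) : ℂ) • e 1 := by
    refine hX.injective (funext fun i => ?_)
    simp only [hG, map_add, map_smul, Pi.add_apply, Pi.smul_apply, smul_eq_mul, hX.coord_basis,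
      Pi.single_apply]
    rcases i with _ | _ | i <;> simp
  have hsolve : ∀ {t : ℝ} {v : X}, t < 1 → ((1 - t : ℝ) : ℂ) • v ∈ M → v ∈ M := by
    intro t v ht hv
    have hne : ((1 - t : ℝ) : ℂ) ≠ 0 := Complex.ofReal_ne_zero.2 (by linarith)
    exact (M.smul_mem_iff hne).1 hv
  have he : ∀ j, e j ∈ M := by
    intro j
    induction j using Nat.twoStepInduction with
    | zero => exact he0
    | one =>
      refine hsolve (hp 1).2 ?_
      rw [eq_sub_of_add_eq' hGe0.symm]
      exact M.sub_mem (hGM _ he0) (M.smul_mem _ he0)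
    | more j h1 h2 =>
      refine hsolve (hp (j + 2)).2 ?_
      rw [eq_sub_of_add_eq' (hGe j).symm]
      exact M.sub_mem (hGM _ h2) (M.smul_mem _ h1)
  have hle : Submodule.span ℂ (Set.range e) ≤ M :=
    Submodule.span_le.2 (by rintro _ ⟨j, rfl⟩; exact he j)
  refine Submodule.eq_top_iff'.2 fun x => ?_
  exact (hM.closure_subset_iff.2 hle) (hX.dense_span x)

end Walk

theorem exists_threshold [CompleteSpace X] (hX : IsSequenceSpace c e) {p : ℕ → ℝ}
    (hp : ∀ n, 0 < p n ∧ p n < 1) {n0 : ℕ} {α : ℝ} (hα : 0 < α)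
    (hge : ∀ n, n0 ≤ n → 1 / 2 + α ≤ p n) {mem : (ℕ → ℂ) → Prop}
    {dlt : (ℕ → ℂ) → (ℕ → ℂ) → ℝ → Prop} (hmem : ∀ x, mem x ↔ ∃ y, c y = x)
    (hdlt : ∀ ε : ℝ, 0 < ε → ∃ η : ℝ, 0 < η ∧ ∀ x y : X, ‖x - y‖ < η → dlt (c x) (c y) ε)
    (hndlt : ∀ x y : X, 1 ≤ ‖c x 0 - c y 0‖ → ¬ dlt (c x) (c y) 1) :
    ∃ δ : ℝ, 1 < δ ∧ ∀ lam : ℂ, δ < ‖lam‖ →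
      FreqHypercyclicOn mem dlt (fun x i => lam * Gop p x i) ∧
      DevaneyOn mem dlt (fun x i => lam * Gop p x i) := by
  obtain ⟨G, hG⟩ := hX.exists_walk hp
  obtain ⟨S, u, hGS, hGu, hu, htop⟩ := exists_generator hG hX hp hα hge
  refine ⟨4 * ‖S‖ + 2, by linarith [norm_nonneg S], fun lam hlam => ?_⟩
  have hpos : 0 < ‖lam‖ := by linarith [norm_nonneg S]
  have hne : lam ≠ 0 := norm_pos_iff.1 hpos
  set N := Submodule.span ℂ (Set.range fun k : ℕ => ((lam⁻¹ • S) ^ k) u) with hN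
  have hsucc : ∀ k : ℕ, S (((lam⁻¹ • S) ^ k) u) = lam • ((lam⁻¹ • S) ^ (k + 1)) u := by
    intro k
    rw [pow_succ', mul_apply_eq_comp, smul_apply, smul_inv_smul₀ hne]
  have hSN : ∀ m ∈ N, S m ∈ N := fun m hm => by
    have : N ≤ N.comap (S : X →ₗ[ℂ] X) := Submodule.span_le.2 (by
      rintro _ ⟨k, rfl⟩
      change S (((lam⁻¹ • S) ^ k) u) ∈ N
      rw [hsucc]
      exact N.smul_mem _ (Submodule.subset_span ⟨k + 1, rfl⟩))
    exact this hm
  have hGN : ∀ m ∈ N, G m ∈ N := fun m hm => by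
    have : N ≤ N.comap (G : X →ₗ[ℂ] X) := Submodule.span_le.2 (by
      rintro _ ⟨k, rfl⟩
      change G (((lam⁻¹ • S) ^ k) u) ∈ N
      rcases k with _ | k
      · rw [pow_zero, one_apply_eq_self, hGu]
        exact N.zero_mem
      · rw [pow_succ', mul_apply_eq_comp, smul_apply, map_smul, hGS]
        exact N.smul_mem _ (Submodule.subset_span ⟨k, rfl⟩))
    exact this hm
  have hdense : Dense (N : Set X) := by
    rw [Submodule.dense_iff_topologicalClosure_eq_top]
    exact htop _ N.isClosed_topologicalClosure
      (N.le_topologicalClosure (Submodule.subset_span ⟨0, by simp⟩))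
      (fun m hm => map_mem_closure S.continuous hm hSN)
      (fun m hm => map_mem_closure G.continuous hm hGN)
  refine freqHypercyclicOn_and_devaneyOn (T := lam • G) (S := lam⁻¹ • S) (u := u) (c := c)
    (fun x => ?_) ?_ ?_ hdense hu (fun x => ?_) hmem hdlt hndlt
  · rw [smul_apply, smul_apply, map_smul, hGS, smul_inv_smul₀ hne]
  · rw [smul_apply, hGu, smul_zero]
  · rw [norm_smul, norm_inv, inv_mul_le_iff₀ hpos]
    linarith
  · funext i
    rw [smul_apply, map_smul, Pi.smul_apply, smul_eq_mul, hG, Gop]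
    rcases i with _ | i <;> simp

end IsSequenceSpace

end SequenceSpace

section Instances

open scoped ENNReal ZeroAtInfty

/-- The coordinate map of `ℓ^r`. -/
noncomputable def lpCoord (r : ℝ≥0∞) : lp (fun _ : ℕ => ℂ) r →ₗ[ℂ] (ℕ → ℂ) where
  toFun x := x
  map_add' x y := lp.coeFn_add x y
  map_smul' a x := lp.coeFn_smul a x

lemma lpCoord_apply (r : ℝ≥0∞) (x : lp (fun _ : ℕ => ℂ) r) : lpCoord r x = x := rfl

lemma sum_rpow_weighted_le {a x : ℕ → ℂ} {σ : ℕ → ℕ} {B r K : ℝ} (hr : 0 < r) (hB : 0 ≤ B)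
    (ha : ∀ i, ‖a i‖ ≤ B) (hσ : Set.InjOn σ {i | a i ≠ 0})
    (hx : ∀ s : Finset ℕ, ∑ i ∈ s, ‖x i‖ ^ r ≤ K) (s : Finset ℕ) :
    ∑ i ∈ s, ‖a i * x (σ i)‖ ^ r ≤ B ^ r * K := by
  classical
  calc ∑ i ∈ s, ‖a i * x (σ i)‖ ^ r
      = ∑ i ∈ s.filter fun i => a i ≠ 0, ‖a i * x (σ i)‖ ^ r := by
        refine (Finset.sum_filter_of_ne (p := fun i => a i ≠ 0) fun i _ h h0 => h ?_).symm
        rw [h0, zero_mul, norm_zero, Real.zero_rpow hr.ne']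
    _ ≤ ∑ i ∈ s.filter fun i => a i ≠ 0, B ^ r * ‖x (σ i)‖ ^ r := by
        refine Finset.sum_le_sum fun i _ => ?_
        rw [← Real.mul_rpow hB (norm_nonneg _), norm_mul]
        exact Real.rpow_le_rpow (by positivity)
          (mul_le_mul_of_nonneg_right (ha i) (norm_nonneg _)) hr.le
    _ = B ^ r * ∑ j ∈ (s.filter fun i => a i ≠ 0).image σ, ‖x j‖ ^ r := by
        have hinj : Set.InjOn σ (s.filter fun i => a i ≠ 0 : Finset ℕ) := fun i hi j hj h =>
          hσ (Finset.mem_filter.1 hi).2 (Finset.mem_filter.1 hj).2 h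
        rw [Finset.sum_image hinj, Finset.mul_sum]
    _ ≤ B ^ r * K := mul_le_mul_of_nonneg_left (hx _) (Real.rpow_nonneg hB r)

lemma isSequenceSpace_lp {r : ℝ≥0∞} [Fact (1 ≤ r)] (hr : r ≠ ∞) :
    IsSequenceSpace (lpCoord r) fun j => lp.single r j (1 : ℂ) where
  injective := Subtype.coe_injective
  norm_coord_le x i := lp.norm_apply_le_norm (zero_lt_one.trans_le Fact.out).ne' x i
  coord_basis j := by
    rw [lpCoord_apply, lp.coeFn_single]
  norm_basis_le j := by
    rw [lp.norm_single (zero_lt_one.trans_le Fact.out), norm_one]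
  dense_span x := by
    have h1 : HasSum (fun i => x i • lp.single r i (1 : ℂ)) x := by
      have := lp.hasSum_single hr x
      simpa [← lp.single_smul] using this
    exact mem_closure_of_tendsto h1 (Eventually.of_forall fun s =>
      Submodule.sum_mem _ fun i _ => Submodule.smul_mem _ _ (Submodule.subset_span ⟨i, rfl⟩))
  exists_weighted a σ B hB ha hσ := by
    have hr0 : 0 < r.toReal := ENNReal.toReal_pos (zero_lt_one.trans_le Fact.out).ne' hr
    have hsum : ∀ (x : lp (fun _ : ℕ => ℂ) r) (s : Finset ℕ),
        ∑ i ∈ s, ‖a i * x (σ i)‖ ^ r.toReal ≤ B ^ r.toReal * ‖x‖ ^ r.toReal := fun x s =>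
      sum_rpow_weighted_le hr0 hB ha hσ (lp.sum_rpow_le_norm_rpow hr0 x) s
    let A : lp (fun _ : ℕ => ℂ) r →ₗ[ℂ] lp (fun _ : ℕ => ℂ) r :=
      { toFun := fun x => ⟨fun i => a i * x (σ i), memℓp_gen' (hsum x)⟩
        map_add' := fun x y => by
          ext i
          exact mul_add _ _ _
        map_smul' := fun t x => by
          ext i
          exact mul_left_comm _ _ _ }
    have hA : ∀ x, ‖A x‖ ≤ B * ‖x‖ := fun x =>
      lp.norm_le_of_forall_sum_le hr0 (by positivity) fun s => by
        rw [Real.mul_rpow hB (norm_nonneg _)]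
        exact hsum x s
    exact ⟨A.mkContinuous B hA, A.mkContinuous_norm_le hB hA, fun _ _ => rfl⟩

/-- The coordinate map of `c₀`. -/
noncomputable def zeroAtInftyCoord : C₀(ℕ, ℂ) →ₗ[ℂ] (ℕ → ℂ) where
  toFun x := x
  map_add' x y := ZeroAtInftyContinuousMap.coe_add x y
  map_smul' a x := ZeroAtInftyContinuousMap.coe_smul a x

lemma zeroAtInftyCoord_apply (x : C₀(ℕ, ℂ)) : zeroAtInftyCoord x = x := rfl

/-- The element of `C₀(ℕ, ℂ)` given by a sequence tending to `0`. -/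
def zeroAtInftyOfTendsto (x : ℕ → ℂ) (hx : Tendsto x atTop (nhds 0)) : C₀(ℕ, ℂ) where
  toFun := x
  continuous_toFun := continuous_of_discreteTopology
  zero_at_infty' := by rwa [cocompact_eq_cofinite, Nat.cofinite_eq_atTop]

lemma tendsto_zeroAtInfty (x : C₀(ℕ, ℂ)) : Tendsto x atTop (nhds 0) := by
  have := x.zero_at_infty'
  rwa [cocompact_eq_cofinite, Nat.cofinite_eq_atTop] at this

lemma norm_zeroAtInfty_apply_le (x : C₀(ℕ, ℂ)) (i : ℕ) : ‖x i‖ ≤ ‖x‖ :=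
  x.toBCF.norm_coe_le_norm i

lemma norm_zeroAtInfty_le {x : C₀(ℕ, ℂ)} {K : ℝ} (hK : 0 ≤ K) (hx : ∀ i, ‖x i‖ ≤ K) :
    ‖x‖ ≤ K :=
  (BoundedContinuousFunction.norm_le (f := x.toBCF) hK).2 hx

lemma tendsto_weighted {a x : ℕ → ℂ} {σ : ℕ → ℕ} {B : ℝ} (ha : ∀ i, ‖a i‖ ≤ B)
    (hσ : Set.InjOn σ {i | a i ≠ 0}) (hx : Tendsto x atTop (nhds 0)) :
    Tendsto (fun i => a i * x (σ i)) atTop (nhds 0) := by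
  have hB : 0 ≤ B := (norm_nonneg _).trans (ha 0)
  rw [← Nat.cofinite_eq_atTop] at hx ⊢
  rw [Metric.tendsto_nhds] at hx ⊢
  intro ε hε
  have h1 := hx (ε / (B + 1)) (by positivity)
  rw [Filter.eventually_cofinite] at h1 ⊢
  refine Set.Finite.of_injOn (f := σ) ?_ (hσ.mono ?_) h1
  · intro i hi hlt
    refine hi ?_
    rw [dist_zero_right] at hlt ⊢
    rw [lt_div_iff₀ (by positivity)] at hlt
    rw [norm_mul]
    calc ‖a i‖ * ‖x (σ i)‖ ≤ (B + 1) * ‖x (σ i)‖ :=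
          mul_le_mul_of_nonneg_right ((ha i).trans (by linarith)) (norm_nonneg _)
      _ = ‖x (σ i)‖ * (B + 1) := mul_comm _ _
      _ < ε := hlt
  · intro i hi h0
    refine hi ?_
    change a i = 0 at h0
    rw [h0, zero_mul, dist_self]
    exact hε

/-- The canonical basis of `C₀(ℕ, ℂ)`. -/
noncomputable def zeroAtInftySingle (j : ℕ) : C₀(ℕ, ℂ) :=
  zeroAtInftyOfTendsto (Pi.single j 1) (tendsto_atTop_of_eventually_const (i₀ := j + 1)
    fun i hi => Pi.single_eq_of_ne (by omega) 1)

lemma isSequenceSpace_zeroAtInfty :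
    IsSequenceSpace zeroAtInftyCoord zeroAtInftySingle where
  injective := DFunLike.coe_injective
  norm_coord_le x i := norm_zeroAtInfty_apply_le x i
  coord_basis j := rfl
  norm_basis_le j := norm_zeroAtInfty_le zero_le_one fun i => by
    change ‖(Pi.single j 1 : ℕ → ℂ) i‖ ≤ 1
    rw [Pi.single_apply]
    split_ifs <;> simp
  dense_span x := by
    refine Metric.mem_closure_iff.2 fun ε hε => ?_
    obtain ⟨N, hN⟩ := Metric.tendsto_atTop.1 (tendsto_zeroAtInfty x) (ε / 2) (by positivity)
    refine ⟨∑ j ∈ Finset.range N, x j • zeroAtInftySingle j,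
      Submodule.sum_mem _ fun i _ => Submodule.smul_mem _ _ (Submodule.subset_span ⟨i, rfl⟩), ?_⟩
    rw [dist_eq_norm]
    refine (norm_zeroAtInfty_le (by positivity : 0 ≤ ε / 2) fun i => ?_).trans_lt (half_lt_self hε)
    have h1 : (x - ∑ j ∈ Finset.range N, x j • zeroAtInftySingle j) i
        = if i < N then 0 else x i := by
      rw [← zeroAtInftyCoord_apply]
      have h2 : ∀ j, zeroAtInftyCoord (zeroAtInftySingle j) i = if i = j then 1 else 0 :=
        fun j => Pi.single_apply j 1 i
      simp only [map_sub, map_sum, map_smul, Pi.sub_apply, Finset.sum_apply, Pi.smul_apply,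
        smul_eq_mul, h2, mul_ite, mul_one, mul_zero, Finset.sum_ite_eq, Finset.mem_range]
      split_ifs <;> simp [zeroAtInftyCoord_apply]
    rw [h1]
    split_ifs with hi
    · rw [norm_zero]
      positivity
    · have := hN i (not_lt.1 hi)
      rw [dist_zero_right] at this
      exact this.le
  exists_weighted a σ B hB ha hσ := by
    let A : C₀(ℕ, ℂ) →ₗ[ℂ] C₀(ℕ, ℂ) :=
      { toFun := fun x => zeroAtInftyOfTendsto (fun i => a i * x (σ i))
          (tendsto_weighted ha hσ (tendsto_zeroAtInfty x))
        map_add' := fun x y => by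
          ext i
          exact mul_add _ _ _
        map_smul' := fun t x => by
          ext i
          exact mul_left_comm _ _ _ }
    have hA : ∀ x, ‖A x‖ ≤ B * ‖x‖ := fun x =>
      norm_zeroAtInfty_le (by positivity) fun i => by
        change ‖a i * x (σ i)‖ ≤ _
        rw [norm_mul]
        exact mul_le_mul (ha i) (norm_zeroAtInfty_apply_le x _) (norm_nonneg _) hB
    exact ⟨A.mkContinuous B hA, A.mkContinuous_norm_le hB hA, fun _ _ => rfl⟩

lemma memc0_iff (x : ℕ → ℂ) : memc0 x ↔ ∃ y, zeroAtInftyCoord y = x :=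
  ⟨fun hx => ⟨zeroAtInftyOfTendsto x hx, rfl⟩, by
    rintro ⟨y, rfl⟩
    exact tendsto_zeroAtInfty y⟩

lemma memlq_iff {q : ℝ} (hq : 1 ≤ q) (x : ℕ → ℂ) :
    memlq q x ↔ ∃ y, lpCoord (ENNReal.ofReal q) y = x := by
  have hr : (ENNReal.ofReal q).toReal = q := ENNReal.toReal_ofReal (by linarith)
  have hmem : memlq q x ↔ Memℓp x (ENNReal.ofReal q) := by
    rw [memℓp_gen_iff (by linarith), hr]
    rfl
  rw [hmem]
  refine ⟨fun hx => ⟨⟨x, hx⟩, rfl⟩, ?_⟩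
  rintro ⟨y, rfl⟩
  exact lp.memℓp y

end Instances

/-- Let `p̄ = (pₙ)` with `pₙ ∈ (0,1)` and let `G = G_{p̄}` be the inhomogeneous random
walk operator on `ℤ₊`.  If there are `n₀ ∈ ℕ` and `α > 0` with `pₙ ≥ 1/2 + α` for all
`n ≥ n₀`, then (for `X = c₀`, and for each `X = ℓ^q` with `q ≥ 1`) there exists `δ > 1`
such that for every `λ ∈ ℂ` with `|λ| > δ`, the operator `λ G` is frequently hypercyclic
and Devaney chaotic on `X`. -/
theorem stmt18 (p : ℕ → ℝ) (hp : ∀ n, 0 < p n ∧ p n < 1)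
    (n0 : ℕ) (α : ℝ) (hα : 0 < α) (hge : ∀ n, n0 ≤ n → 1/2 + α ≤ p n) :
    (∃ δ : ℝ, 1 < δ ∧ ∀ lam : ℂ, δ < ‖lam‖ →
      FreqHypercyclicOn memc0 distC0lt (fun x i => lam * Gop p x i) ∧
      DevaneyOn memc0 distC0lt (fun x i => lam * Gop p x i)) ∧
    (∀ q : ℝ, 1 ≤ q → ∃ δ : ℝ, 1 < δ ∧ ∀ lam : ℂ, δ < ‖lam‖ →
      FreqHypercyclicOn (memlq q) (distLqlt q) (fun x i => lam * Gop p x i) ∧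
      DevaneyOn (memlq q) (distLqlt q) (fun x i => lam * Gop p x i)) := by
  refine ⟨?_, fun q hq => ?_⟩
  · refine isSequenceSpace_zeroAtInfty.exists_threshold hp hα hge memc0_iff
      (fun ε hε => ⟨ε, hε, fun x y hxy i => ?_⟩) fun x y hxy hlt => (hlt 0).not_ge hxy
    exact (isSequenceSpace_zeroAtInfty.norm_coord_le (x - y) i).trans_lt hxy
  · have hr : (ENNReal.ofReal q).toReal = q := ENNReal.toReal_ofReal (by linarith)
    have hq0 : 0 < q := by linarith
    have : Fact (1 ≤ ENNReal.ofReal q) := ⟨ENNReal.one_le_ofReal.2 hq⟩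
    have hX := isSequenceSpace_lp (r := ENNReal.ofReal q) ENNReal.ofReal_ne_top
    have hnorm : ∀ x y : lp (fun _ : ℕ => ℂ) (ENNReal.ofReal q),
        ∑' i, ‖lpCoord _ x i - lpCoord _ y i‖ ^ q = ‖x - y‖ ^ q := fun x y => by
      have := lp.norm_rpow_eq_tsum (by linarith : 0 < (ENNReal.ofReal q).toReal) (x - y)
      rw [hr] at this
      exact this.symm
    refine hX.exists_threshold hp hα hge (memlq_iff hq)
      (fun ε hε => ⟨ε ^ q⁻¹, by positivity, fun x y hxy => ?_⟩) fun x y hxy hlt => ?_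
    · rw [distLqlt, hnorm]
      exact (Real.lt_rpow_inv_iff_of_pos (norm_nonneg _) hε.le hq0).1 hxy
    · rw [distLqlt, hnorm] at hlt
      exact hlt.not_ge (Real.one_le_rpow (hxy.trans (hX.norm_coord_le (x - y) 0)) hq0.le)
end

section
/- Let p̄ = (p_n)_{n≥0} be a sequence with p_n ∈ (0,1), let G = G_{p̄} be the associated inhomogeneous random walk operator on ℤ_+, and let (w_n)_{n≥1} be the associated weight sequence. Suppose either: X = c_0 and Σ_{n=1}^{∞} w_n^{−1} < ∞; or X = l^1 and the sequence (1/w_n)_{n≥1} is bounded; or X = l^q for some q > 1 and Σ_{n=1}^{∞} w_n^{−q/(q−1)} < ∞. Then for every λ ∈ ℂ with |λ| > 1, the operator λG is not hypercyclic on X. -/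
open Filter

theorem Gop_apply (p : ℕ → ℝ) (x : ℕ → ℂ) (i : ℕ) :
    Gop p x i = ((1 - p i : ℝ) : ℂ) * x (i - 1) + ((p i : ℝ) : ℂ) * x (i + 1) := by
  unfold Gop
  split_ifs with h
  · subst h; simp
  · rfl

theorem wseq_pos {p : ℕ → ℝ} (hp : ∀ n, 0 < p n ∧ p n < 1) (n : ℕ) : 0 < wseq p n := by
  have h : ∀ k, 0 < (1 - p k) / p k := fun k => div_pos (sub_pos.2 (hp k).2) (hp k).1
  unfold wseq
  split_ifs <;> exact Finset.prod_pos fun k _ => h k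

theorem wseq_one (p : ℕ → ℝ) : wseq p 1 = (1 - p 0) / p 0 := by
  simp [wseq, Finset.range_one, Finset.filter_singleton]

theorem wseq_add_two (p : ℕ → ℝ) (n : ℕ) :
    wseq p (n + 2) = wseq p n * ((1 - p (n + 1)) / p (n + 1)) := by
  unfold wseq
  rcases Nat.mod_two_eq_zero_or_one n with h | h
  · have h1 : (n + 1) % 2 = 1 := by omega
    have h2 : (n + 2) % 2 = 0 := by omega
    rw [if_pos h, if_pos h2, Finset.prod_filter, Finset.prod_filter, Finset.prod_range_succ,
      Finset.prod_range_succ]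
    simp [h, h1]
  · have h1 : (n + 1) % 2 = 0 := by omega
    have h2 : (n + 2) % 2 = 1 := by omega
    rw [if_neg (by omega), if_neg (by omega), Finset.prod_filter, Finset.prod_filter,
      Finset.prod_range_succ, Finset.prod_range_succ]
    simp [h, h1]

/-- A sequence spanning the kernel of the transpose of `Gop p`. -/
noncomputable def kerTranspose (p : ℕ → ℝ) (n : ℕ) : ℝ :=
  (-1) ^ ((n + 1) / 2) / (p n * wseq p (n + 1))

theorem kerTranspose_zero_ne {p : ℕ → ℝ} (hp : ∀ n, 0 < p n ∧ p n < 1) :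
    kerTranspose p 0 ≠ 0 := by
  have := (hp 0).1.ne'
  have := (wseq_pos hp 1).ne'
  simp [kerTranspose, *]

theorem one_sub_mul_kerTranspose_one {p : ℕ → ℝ} (hp : ∀ n, 0 < p n ∧ p n < 1) :
    (1 - p 1) * kerTranspose p 1 = -((1 - p 0) * kerTranspose p 0) := by
  have h0 := (hp 0).1.ne'
  have h1 := (hp 1).1.ne'
  have h0' := (sub_pos.2 (hp 0).2).ne'
  have h1' := (sub_pos.2 (hp 1).2).ne'
  have w0 : wseq p 0 = 1 := by simp [wseq]
  have w2 : wseq p 2 = (1 - p 1) / p 1 := by rw [wseq_add_two p 0, w0, one_mul]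
  simp only [kerTranspose, zero_add, wseq_one, Nat.reduceAdd, Nat.reduceDiv, w2]
  field_simp

theorem one_sub_mul_kerTranspose_add_two {p : ℕ → ℝ} (hp : ∀ n, 0 < p n ∧ p n < 1) (n : ℕ) :
    (1 - p (n + 2)) * kerTranspose p (n + 2) = -(p n * kerTranspose p n) := by
  have h0 := (hp n).1.ne'
  have h2 := (hp (n + 2)).1.ne'
  have h2' := (sub_pos.2 (hp (n + 2)).2).ne'
  have hw := (wseq_pos hp (n + 1)).ne'
  have hs : (n + 2 + 1) / 2 = (n + 1) / 2 + 1 := by omega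
  have w3 : wseq p (n + 2 + 1) = wseq p (n + 1) * ((1 - p (n + 2)) / p (n + 2)) :=
    wseq_add_two p (n + 1)
  simp only [kerTranspose, hs, w3, pow_succ]
  field_simp

theorem abs_kerTranspose_add_two {p : ℕ → ℝ} (hp : ∀ n, 0 < p n ∧ p n < 1) (n : ℕ) :
    |kerTranspose p (n + 2)| = (wseq p (n + 1))⁻¹ + (wseq p (n + 3))⁻¹ := by
  have h2 := (hp (n + 2)).1
  have h2' := sub_pos.2 (hp (n + 2)).2
  have hw := wseq_pos hp (n + 1)
  have hw3 := wseq_pos hp (n + 3)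
  have w3 : wseq p (n + 3) = wseq p (n + 1) * ((1 - p (n + 2)) / p (n + 2)) :=
    wseq_add_two p (n + 1)
  rw [kerTranspose, abs_div, abs_pow, abs_neg, abs_one, one_pow,
    abs_of_pos (mul_pos h2 (wseq_pos hp _))]
  change 1 / (p (n + 2) * wseq p (n + 3)) = _
  rw [w3]
  have := h2.ne'
  have := h2'.ne'
  have := hw.ne'
  field_simp
  ring

theorem sum_kerTranspose_mul_Gop {p : ℕ → ℝ} (hp : ∀ n, 0 < p n ∧ p n < 1) (x : ℕ → ℂ) (N : ℕ) :
    ∑ i ∈ Finset.range (N + 1), (kerTranspose p i : ℂ) * Gop p x i =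
      ((p N * kerTranspose p N : ℝ) : ℂ) * x (N + 1) -
        (((1 - p (N + 1)) * kerTranspose p (N + 1) : ℝ) : ℂ) * x N := by
  induction N with
  | zero =>
    rw [Finset.sum_range_one, Gop_apply, zero_add, one_sub_mul_kerTranspose_one hp]
    push_cast
    ring
  | succ N ih =>
    rw [Finset.sum_range_succ, ih, one_sub_mul_kerTranspose_add_two hp N, Gop_apply]
    simp only [Nat.add_sub_cancel]
    push_cast
    ring

/-- The functional given by the sequence `kerTranspose p`. -/
noncomputable def kerFunctional (p : ℕ → ℝ) (x : ℕ → ℂ) : ℂ := ∑' i, (kerTranspose p i : ℂ) * x i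

theorem kerFunctional_Gop {p : ℕ → ℝ} (hp : ∀ n, 0 < p n ∧ p n < 1) {C : ℝ}
    (hC : ∀ n, |kerTranspose p n| ≤ C) {x : ℕ → ℂ} (hx : Tendsto x atTop (nhds 0))
    (hs : Summable fun i => (kerTranspose p i : ℂ) * Gop p x i) :
    kerFunctional p (Gop p x) = 0 := by
  have h1 := hs.hasSum.tendsto_sum_nat.comp (tendsto_add_atTop_nat 1)
  refine tendsto_nhds_unique h1 ?_
  have hbound : ∀ (n m : ℕ) (a : ℝ), 0 ≤ a → a ≤ 1 →
      ‖((a * kerTranspose p n : ℝ) : ℂ) * x m‖ ≤ C * ‖x m‖ := by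
    intro n m a ha ha1
    rw [norm_mul, Complex.norm_real, Real.norm_eq_abs, abs_mul, abs_of_nonneg ha]
    gcongr
    exact (mul_le_of_le_one_left (abs_nonneg _) ha1).trans (hC n)
  have hx' : Tendsto (fun n => C * ‖x n‖) atTop (nhds 0) := by
    simpa using hx.norm.const_mul C
  have hl : Tendsto (fun N => ((p N * kerTranspose p N : ℝ) : ℂ) * x (N + 1)) atTop (nhds 0) :=
    squeeze_zero_norm (fun N => hbound N (N + 1) _ (hp N).1.le (hp N).2.le)
      (hx'.comp (tendsto_add_atTop_nat 1))
  have hr : Tendsto (fun N => (((1 - p (N + 1)) * kerTranspose p (N + 1) : ℝ) : ℂ) * x N) atTop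
      (nhds 0) :=
    squeeze_zero_norm (fun N => hbound (N + 1) N _ (by linarith [(hp (N + 1)).2])
      (by linarith [(hp (N + 1)).1])) hx'
  have h2 := hl.sub hr
  rw [sub_zero] at h2
  exact h2.congr fun N => (sum_kerTranspose_mul_Gop hp x N).symm

/-- An operator whose range lies in the kernel of a nonzero functional is not hypercyclic. -/
theorem not_hypercyclicOn_of_functional {mem : (ℕ → ℂ) → Prop}
    {dlt : (ℕ → ℂ) → (ℕ → ℂ) → ℝ → Prop} {T : (ℕ → ℂ) → ℕ → ℂ} (φ : (ℕ → ℂ) → ℂ)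
    (hT : ∀ x, mem x → mem (T x)) (hφT : ∀ x, mem x → φ (T x) = 0)
    (hφ : ∃ ε > 0, ∀ u z, mem u → mem z → dlt u z ε → ‖φ u - φ z‖ < 1)
    (hsurj : ∀ c : ℂ, ∃ z, mem z ∧ φ z = c) : ¬ HypercyclicOn mem dlt T := by
  rintro ⟨x, hx, hdense⟩
  obtain ⟨ε, hε, hcont⟩ := hφ
  obtain ⟨z, hz, hφz⟩ := hsurj ((‖φ x‖ + 1 : ℝ) : ℂ)
  obtain ⟨n, hn⟩ := hdense z hz ε hε
  have hmem : ∀ n, mem (T^[n] x) := by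
    intro n
    induction n with
    | zero => exact hx
    | succ n ih => rw [Function.iterate_succ_apply']; exact hT _ ih
  have hlt := hcont _ _ (hmem n) hz hn
  have hnorm : ‖φ z‖ = ‖φ x‖ + 1 := by
    rw [hφz, Complex.norm_real, Real.norm_of_nonneg (by positivity)]
  cases n with
  | zero =>
    have := norm_sub_norm_le (φ z) (φ x)
    rw [norm_sub_rev] at this
    simp only [Function.iterate_zero, id] at hlt
    linarith
  | succ n =>
    rw [Function.iterate_succ_apply', hφT _ (hmem n), zero_sub, norm_neg, hnorm] at hlt
    linarith [norm_nonneg (φ x)]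

theorem not_hypercyclicOn_smul_Gop {p : ℕ → ℝ} (hp : ∀ n, 0 < p n ∧ p n < 1)
    {mem : (ℕ → ℂ) → Prop} {dlt : (ℕ → ℂ) → (ℕ → ℂ) → ℝ → Prop} (lam : ℂ)
    (hbdd : ∃ C, ∀ n, |kerTranspose p n| ≤ C)
    (htend : ∀ x, mem x → Tendsto x atTop (nhds 0))
    (hG : ∀ x, mem x → mem (Gop p x)) (hsmul : ∀ (c : ℂ) x, mem x → mem fun i => c * x i)
    (hsingle : ∀ c : ℂ, mem (Pi.single 0 c))
    (hsum : ∀ x, mem x → Summable fun i => |kerTranspose p i| * ‖x i‖)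
    (hcont : ∃ ε > 0, ∀ u z, mem u → mem z → dlt u z ε →
      ∑' i, |kerTranspose p i| * ‖u i - z i‖ < 1) :
    ¬ HypercyclicOn mem dlt (fun x i => lam * Gop p x i) := by
  obtain ⟨C, hC⟩ := hbdd
  have hnorm : ∀ (x : ℕ → ℂ) i, ‖(kerTranspose p i : ℂ) * x i‖ = |kerTranspose p i| * ‖x i‖ := by
    intro x i
    rw [norm_mul, Complex.norm_real, Real.norm_eq_abs]
  have hsum' : ∀ x, mem x → Summable fun i => (kerTranspose p i : ℂ) * x i := fun x hx =>
    Summable.of_norm (by simpa only [hnorm] using hsum x hx)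
  refine not_hypercyclicOn_of_functional (kerFunctional p) (fun x hx => hsmul _ _ (hG x hx))
    ?_ ?_ ?_
  · intro x hx
    have h := kerFunctional_Gop hp hC (htend x hx) (hsum' _ (hG x hx))
    unfold kerFunctional at h ⊢
    simp only [mul_left_comm _ lam]
    rw [tsum_mul_left, h, mul_zero]
  · obtain ⟨ε, hε, h⟩ := hcont
    refine ⟨ε, hε, fun u z hu hz hd => lt_of_le_of_lt ?_ (h u z hu hz hd)⟩
    have hs : Summable fun i => ‖(kerTranspose p i : ℂ) * (u i - z i)‖ := by
      refine Summable.of_nonneg_of_le (fun _ => norm_nonneg _) (fun i => ?_)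
        ((hsum u hu).add (hsum z hz))
      rw [hnorm (fun i => u i - z i), ← mul_add]
      exact mul_le_mul_of_nonneg_left (norm_sub_le _ _) (abs_nonneg _)
    unfold kerFunctional
    rw [← (hsum' u hu).tsum_sub (hsum' z hz)]
    simp only [← mul_sub]
    refine (norm_tsum_le_tsum_norm hs).trans_eq (tsum_congr fun i => ?_)
    exact hnorm (fun i => u i - z i) i
  · intro c
    refine ⟨Pi.single 0 (c / (kerTranspose p 0 : ℂ)), hsingle _, ?_⟩
    have h0 : (kerTranspose p 0 : ℂ) ≠ 0 := Complex.ofReal_ne_zero.2 (kerTranspose_zero_ne hp)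
    unfold kerFunctional
    rw [tsum_eq_single 0 fun i hi => by simp [hi], Pi.single_eq_same, mul_div_cancel₀ _ h0]

theorem norm_Gop_le {p : ℕ → ℝ} (hp : ∀ n, 0 < p n ∧ p n < 1) (x : ℕ → ℂ) (i : ℕ) :
    ‖Gop p x i‖ ≤ ‖x (i - 1)‖ + ‖x (i + 1)‖ := by
  rw [Gop_apply]
  refine (norm_add_le _ _).trans (add_le_add ?_ ?_) <;>
  · rw [norm_mul, Complex.norm_real, Real.norm_of_nonneg (by linarith [(hp i).1, (hp i).2])]
    exact mul_le_of_le_one_left (norm_nonneg _) (by linarith [(hp i).1, (hp i).2])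

theorem memc0_Gop {p : ℕ → ℝ} (hp : ∀ n, 0 < p n ∧ p n < 1) {x : ℕ → ℂ} (hx : memc0 x) :
    memc0 (Gop p x) := by
  refine squeeze_zero_norm (norm_Gop_le hp x) ?_
  simpa using (hx.comp (tendsto_sub_atTop_nat 1)).norm.add
    (hx.comp (tendsto_add_atTop_nat 1)).norm

theorem memlq_Gop {p : ℕ → ℝ} (hp : ∀ n, 0 < p n ∧ p n < 1) {q : ℝ} (hq : 1 ≤ q) {x : ℕ → ℂ}
    (hx : memlq q x) : memlq q (Gop p x) := by
  have h1 : Summable fun i => ‖x (i - 1)‖ ^ q :=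
    (summable_nat_add_iff 1).1 (by simpa [memlq] using hx)
  have h2 : Summable fun i => ‖x (i + 1)‖ ^ q := (summable_nat_add_iff 1).2 hx
  exact Summable.of_nonneg_of_le (fun _ => by positivity)
    (fun i => Real.rpow_le_rpow (norm_nonneg _) (norm_Gop_le hp x i) (by linarith))
    (Real.summable_Lp_add_of_nonneg hq (fun _ => norm_nonneg _) (fun _ => norm_nonneg _) h1 h2)

theorem memlq.sub {q : ℝ} (hq : 1 ≤ q) {u z : ℕ → ℂ} (hu : memlq q u) (hz : memlq q z) :
    memlq q fun i => u i - z i :=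
  Summable.of_nonneg_of_le (fun _ => by positivity)
    (fun _ => Real.rpow_le_rpow (norm_nonneg _) (norm_sub_le _ _) (by linarith))
    (Real.summable_Lp_add_of_nonneg hq (fun _ => norm_nonneg _) (fun _ => norm_nonneg _) hu hz)

theorem memlq.const_mul {q : ℝ} (c : ℂ) {x : ℕ → ℂ} (hx : memlq q x) :
    memlq q fun i => c * x i := by
  unfold memlq at *
  simp only [norm_mul, Real.mul_rpow (norm_nonneg _) (norm_nonneg _)]
  exact hx.mul_left _

theorem memlq_single {q : ℝ} (hq : 1 ≤ q) (c : ℂ) : memlq q (Pi.single 0 c) := by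
  refine summable_of_ne_finset_zero (s := {0}) fun i hi => ?_
  rw [Finset.mem_singleton] at hi
  simp [hi, Real.zero_rpow (by linarith : q ≠ 0)]

theorem tendsto_zero_of_summable_rpow {q : ℝ} (hq : 0 < q) {f : ℕ → ℝ} (hf : ∀ n, 0 ≤ f n)
    (h : Summable fun n => f n ^ q) : Tendsto f atTop (nhds 0) := by
  have h1 := h.tendsto_atTop_zero.rpow_const (p := q⁻¹) (Or.inr (by positivity))
  rw [Real.zero_rpow (by positivity)] at h1
  exact h1.congr fun n => Real.rpow_rpow_inv (hf n) hq.ne'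

theorem memlq.tendsto {q : ℝ} (hq : 1 ≤ q) {x : ℕ → ℂ} (hx : memlq q x) :
    Tendsto x atTop (nhds 0) :=
  tendsto_zero_iff_norm_tendsto_zero.2
    (tendsto_zero_of_summable_rpow (by linarith) (fun _ => norm_nonneg _) hx)

theorem bddAbove_kerTranspose {p : ℕ → ℝ} (hp : ∀ n, 0 < p n ∧ p n < 1) {C : ℝ}
    (hC : ∀ n, (wseq p (n + 1))⁻¹ ≤ C) : ∃ D, ∀ n, |kerTranspose p n| ≤ D := by
  refine ⟨|kerTranspose p 0| + |kerTranspose p 1| + 2 * C, fun n => ?_⟩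
  have hC0 : 0 ≤ C := (inv_pos.2 (wseq_pos hp 1)).le.trans (hC 0)
  have h0 := abs_nonneg (kerTranspose p 0)
  have h1 := abs_nonneg (kerTranspose p 1)
  match n with
  | 0 => linarith
  | 1 => linarith
  | n + 2 =>
    rw [abs_kerTranspose_add_two hp]
    linarith [hC n, hC (n + 2)]

theorem summable_kerTranspose_rpow {p : ℕ → ℝ} (hp : ∀ n, 0 < p n ∧ p n < 1) {r : ℝ} (hr : 1 ≤ r)
    (h : Summable fun n => (wseq p (n + 1))⁻¹ ^ r) : Summable fun n => |kerTranspose p n| ^ r := by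
  have hpos : ∀ n, 0 ≤ (wseq p n)⁻¹ := fun n => (inv_pos.2 (wseq_pos hp n)).le
  refine (summable_nat_add_iff 2).1 ?_
  simp only [abs_kerTranspose_add_two hp]
  exact Real.summable_Lp_add_of_nonneg hr (fun _ => hpos _) (fun _ => hpos _) h
    ((summable_nat_add_iff 2).2 h)

theorem not_hypercyclicOn_memc0 {p : ℕ → ℝ} (hp : ∀ n, 0 < p n ∧ p n < 1)
    (h : Summable fun n : ℕ => (wseq p (n + 1))⁻¹) (lam : ℂ) :
    ¬ HypercyclicOn memc0 distC0lt (fun x i => lam * Gop p x i) := by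
  have hy : Summable fun n => |kerTranspose p n| := by
    simpa using summable_kerTranspose_rpow hp le_rfl (by simpa using h)
  have hC : ∀ n, (wseq p (n + 1))⁻¹ ≤ ∑' n, (wseq p (n + 1))⁻¹ := fun n =>
    h.le_tsum n fun _ _ => (inv_pos.2 (wseq_pos hp _)).le
  have hS : 0 ≤ ∑' n, |kerTranspose p n| := tsum_nonneg fun _ => abs_nonneg _
  refine not_hypercyclicOn_smul_Gop hp lam (bddAbove_kerTranspose hp hC) (fun _ hx => hx)
    (fun x hx => memc0_Gop hp hx) (fun c x hx => ?_) (fun c => ?_) (fun x hx => ?_) ?_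
  · simpa [memc0] using Tendsto.const_mul c hx
  · refine tendsto_const_nhds.congr' ?_
    filter_upwards [eventually_ne_atTop 0] with i hi
    simp [hi]
  · obtain ⟨B, hB⟩ := (Tendsto.norm hx).bddAbove_range
    exact Summable.of_nonneg_of_le (fun _ => by positivity)
      (fun i => mul_le_mul_of_nonneg_left (hB ⟨i, rfl⟩) (abs_nonneg _)) (hy.mul_right B)
  · refine ⟨1 / (∑' n, |kerTranspose p n| + 1), by positivity, fun u z _ _ hd => ?_⟩
    have hle : ∀ i, |kerTranspose p i| * ‖u i - z i‖ ≤
        |kerTranspose p i| * (1 / (∑' n, |kerTranspose p n| + 1)) := fun i =>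
      mul_le_mul_of_nonneg_left (hd i).le (abs_nonneg _)
    have hs := Summable.of_nonneg_of_le (fun _ => by positivity) hle (hy.mul_right _)
    refine (hs.tsum_le_tsum hle (hy.mul_right _)).trans_lt ?_
    rw [tsum_mul_right, mul_one_div, div_lt_one (by positivity)]
    linarith

theorem not_hypercyclicOn_memlq_one {p : ℕ → ℝ} (hp : ∀ n, 0 < p n ∧ p n < 1)
    (h : ∃ C : ℝ, ∀ n : ℕ, (wseq p (n + 1))⁻¹ ≤ C) (lam : ℂ) :
    ¬ HypercyclicOn (memlq 1) (distLqlt 1) (fun x i => lam * Gop p x i) := by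
  obtain ⟨C, hC⟩ := h
  obtain ⟨D, hD⟩ := bddAbove_kerTranspose hp hC
  have hD0 : 0 ≤ D := (abs_nonneg _).trans (hD 0)
  have hle : ∀ (x : ℕ → ℂ) i, |kerTranspose p i| * ‖x i‖ ≤ D * ‖x i‖ ^ (1 : ℝ) := fun x i => by
    rw [Real.rpow_one]
    exact mul_le_mul_of_nonneg_right (hD i) (norm_nonneg _)
  have hsum : ∀ x, memlq 1 x → Summable fun i => |kerTranspose p i| * ‖x i‖ := fun x hx =>
    Summable.of_nonneg_of_le (fun _ => by positivity) (hle x) (Summable.mul_left D hx)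
  refine not_hypercyclicOn_smul_Gop hp lam ⟨D, hD⟩ (fun _ hx => hx.tendsto le_rfl)
    (fun x hx => memlq_Gop hp le_rfl hx) (fun c x hx => hx.const_mul c)
    (memlq_single le_rfl) hsum ⟨1 / (D + 1), by positivity, fun u z hu hz hd => ?_⟩
  have huz := hu.sub le_rfl hz
  refine ((hsum _ huz).tsum_le_tsum (hle _) (Summable.mul_left D huz)).trans_lt ?_
  rw [tsum_mul_left]
  have h1 : D * (∑' i, ‖u i - z i‖ ^ (1 : ℝ)) ≤ D * (1 / (D + 1)) :=
    mul_le_mul_of_nonneg_left (le_of_lt hd) hD0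
  refine h1.trans_lt ?_
  rw [mul_one_div, div_lt_one (by positivity)]
  linarith

theorem not_hypercyclicOn_memlq {p : ℕ → ℝ} (hp : ∀ n, 0 < p n ∧ p n < 1) {q : ℝ} (hq : 1 < q)
    (h : Summable fun n : ℕ => wseq p (n + 1) ^ (-(q / (q - 1)))) (lam : ℂ) :
    ¬ HypercyclicOn (memlq q) (distLqlt q) (fun x i => lam * Gop p x i) := by
  have hqr : (q / (q - 1)).HolderConjugate q := (Real.HolderConjugate.conjExponent hq).symm
  set r := q / (q - 1)
  have hr : 1 ≤ r := hqr.lt.le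
  have hw : ∀ n, 0 ≤ (wseq p (n + 1))⁻¹ := fun n => (inv_pos.2 (wseq_pos hp _)).le
  have h' : Summable fun n => (wseq p (n + 1))⁻¹ ^ r := by
    refine h.congr fun n => ?_
    rw [Real.rpow_neg (wseq_pos hp _).le, Real.inv_rpow (wseq_pos hp _).le]
  obtain ⟨C, hC⟩ := (tendsto_zero_of_summable_rpow (by linarith) hw h').bddAbove_range
  have hy := summable_kerTranspose_rpow hp hr h'
  have hsum : ∀ x, memlq q x → Summable fun i => |kerTranspose p i| * ‖x i‖ := fun x hx =>
    Real.summable_mul_of_Lp_Lq_of_nonneg hqr (fun _ => abs_nonneg _) (fun _ => norm_nonneg _) hy hx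
  set S := (∑' i, |kerTranspose p i| ^ r) ^ (1 / r) with hSdef
  have hS : 0 ≤ S := Real.rpow_nonneg (tsum_nonneg fun _ => by positivity) _
  refine not_hypercyclicOn_smul_Gop hp lam (bddAbove_kerTranspose hp fun n => hC ⟨n, rfl⟩)
    (fun _ hx => hx.tendsto hq.le) (fun x hx => memlq_Gop hp hq.le hx)
    (fun c x hx => hx.const_mul c) (memlq_single hq.le) hsum
    ⟨(1 / (S + 1)) ^ q, by positivity, fun u z hu hz hd => ?_⟩
  refine (Real.inner_le_Lp_mul_Lq_tsum_of_nonneg hqr (fun _ => abs_nonneg _)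
    (fun _ => norm_nonneg _) hy (hu.sub hq.le hz)).trans_lt ?_
  have h1 : (∑' i, ‖u i - z i‖ ^ q) ^ (1 / q) ≤ 1 / (S + 1) := by
    rw [one_div q, Real.rpow_inv_le_iff_of_pos (tsum_nonneg fun _ => by positivity)
      (by positivity) (by linarith)]
    exact le_of_lt hd
  refine (mul_le_mul_of_nonneg_left h1 hS).trans_lt ?_
  rw [mul_one_div, div_lt_one (by positivity)]
  linarith

/-- Let `p̄ = (pₙ)` with `pₙ ∈ (0,1)`, `G = G_{p̄}` the inhomogeneous random walk
operator on `ℤ₊`, with weights `(wₙ)_{n ≥ 1}`.  If `X = c₀` and `∑ wₙ⁻¹ < ∞`, or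
`X = ℓ¹` and `(1/wₙ)` is bounded, or `X = ℓ^q` with `q > 1` and
`∑ wₙ^{-q/(q-1)} < ∞`, then `λ G` is not hypercyclic on `X` for any `|λ| > 1`. -/
theorem stmt19 (p : ℕ → ℝ) (hp : ∀ n, 0 < p n ∧ p n < 1) :
    ((Summable fun n : ℕ => (wseq p (n + 1))⁻¹) →
      ∀ lam : ℂ, 1 < ‖lam‖ →
        ¬ HypercyclicOn memc0 distC0lt (fun x i => lam * Gop p x i)) ∧
    ((∃ C : ℝ, ∀ n : ℕ, (wseq p (n + 1))⁻¹ ≤ C) →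
      ∀ lam : ℂ, 1 < ‖lam‖ →
        ¬ HypercyclicOn (memlq 1) (distLqlt 1) (fun x i => lam * Gop p x i)) ∧
    (∀ q : ℝ, 1 < q → (Summable fun n : ℕ => wseq p (n + 1) ^ (-(q / (q - 1)))) →
      ∀ lam : ℂ, 1 < ‖lam‖ →
        ¬ HypercyclicOn (memlq q) (distLqlt q) (fun x i => lam * Gop p x i)) := by
  exact ⟨fun h lam _ => not_hypercyclicOn_memc0 hp h lam,
    fun h lam _ => not_hypercyclicOn_memlq_one hp h lam,
    fun _ hq h lam _ => not_hypercyclicOn_memlq hp hq h lam⟩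
end
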